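/- arXiv:2108.03535 — 10 statements merged into one kernel-verified Lean document; each statement's English description precedes it below -/
import Mathlib

section
/- Let (X, d) be an ultrametric space. For any integers n > m ≥ 1 and any real number L > 1 there exists a retraction r : X(n) → X(m) that is L-Lipschitz with respect to the Hausdorff metric. -/
/-- `A` is a member of the finite subset space `Y(n)` of the subset `Y` of a metric
space: `A` is a nonempty subset of `Y` with at most `n` elements. -/
def MemFinSubsetSpace {X : Type*} (Y : Set X) (n : ℕ) (A : Set X) : Prop :=
  A.Finite ∧ A.Nonempty ∧ A.ncard ≤ n ∧ A ⊆ Y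

/-- `r` is a retraction from `Y(n)` onto `Y(m)` which is `L`-Lipschitz with respect to
the Hausdorff metric. -/
def IsLipschitzRetraction {X : Type*} [MetricSpace X] (Y : Set X) (n m : ℕ) (L : ℝ)
    (r : Set X → Set X) : Prop :=
  (∀ A, MemFinSubsetSpace Y n A → MemFinSubsetSpace Y m (r A)) ∧
  (∀ A, MemFinSubsetSpace Y m A → r A = A) ∧
  (∀ A B, MemFinSubsetSpace Y n A → MemFinSubsetSpace Y n B →
    Metric.hausdorffDist (r A) (r B) ≤ L * Metric.hausdorffDist A B)

open Metric TopologicalSpace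

theorem IsUltrametricDist.infDist_le_infDist_of_dist_lt {Y : Type*} [PseudoMetricSpace Y]
    [IsUltrametricDist Y] {Z : Set Y} (hne : Z.Nonempty) {x y : Y}
    (h : dist x y < infDist x Z) : infDist x Z ≤ infDist y Z := by
  by_contra! hlt
  obtain ⟨z, hz, hyz⟩ := (infDist_lt_iff hne).1 hlt
  exact (infDist_le_dist_of_mem hz).not_gt ((dist_triangle_max x y z).trans_lt (max_lt h hyz))

theorem IsUltrametricDist.ball_infDist_eq_of_mem {Y : Type*} [PseudoMetricSpace Y]
    [IsUltrametricDist Y] {Z : Set Y} (hne : Z.Nonempty) {x y : Y}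
    (h : y ∈ ball x (infDist x Z)) : ball x (infDist x Z) = ball y (infDist y Z) := by
  have hxy : dist x y < infDist x Z := by rwa [mem_ball'] at h
  have hle := infDist_le_infDist_of_dist_lt hne hxy
  have hyx : dist y x < infDist y Z := by rw [dist_comm]; exact hxy.trans_le hle
  rw [ball_eq_of_mem h, hle.antisymm (infDist_le_infDist_of_dist_lt hne hyx)]

/-- A nonempty closed subset of an ultrametric space is an `L`-Lipschitz retract of the space for
every `L > 1`. -/
theorem IsUltrametricDist.exists_lipschitz_retraction {Y : Type*} [PseudoMetricSpace Y]
    [IsUltrametricDist Y] {Z : Set Y} (hZ : IsClosed Z) (hne : Z.Nonempty) {L : ℝ} (hL : 1 < L) :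
    ∃ r : Y → Y, (∀ y, r y ∈ Z) ∧ (∀ z ∈ Z, r z = z) ∧
      ∀ x y, dist (r x) (r y) ≤ L * dist x y := by
  classical
  have hpos : ∀ y ∉ Z, 0 < infDist y Z := fun y hy => (hZ.notMem_iff_infDist_pos hne).1 hy
  have happrox : ∀ y, ∃ z ∈ Z, y ∉ Z → dist y z < L * infDist y Z := by
    intro y
    by_cases hy : y ∈ Z
    · exact ⟨y, hy, fun h => absurd hy h⟩
    · obtain ⟨z, hz, h⟩ := (infDist_lt_iff hne).1 (lt_mul_of_one_lt_left (hpos y hy) hL)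
      exact ⟨z, hz, fun _ => h⟩
  choose g hgZ hg using happrox
  let f : Y → Set Y := fun y => ball y (infDist y Z)
  let p : Y → Y := fun y => Set.rangeSplitting f ⟨f y, y, rfl⟩
  have hp : ∀ y, f (p y) = f y := fun y => Set.apply_rangeSplitting f ⟨f y, y, rfl⟩
  have hpeq : ∀ x y, f x = f y → p x = p y := fun x y h => by simp only [p, h]
  let r : Y → Y := fun y => if y ∈ Z then y else g (p y)
  have hrZ : ∀ z ∈ Z, r z = z := fun z hz => if_pos hz
  have hr : ∀ y ∉ Z, r y = g (p y) := fun y hy => if_neg hy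
  have hdist : ∀ y ∉ Z, dist y (r y) ≤ L * infDist y Z := by
    intro y hy
    have hmem : y ∈ f (p y) := by rw [hp]; exact mem_ball_self (hpos y hy)
    have hlt : dist (p y) y < infDist (p y) Z := by rwa [mem_ball'] at hmem
    have hle := infDist_le_infDist_of_dist_lt hne hlt
    have hpy : p y ∉ Z := fun h => by
      rw [infDist_zero_of_mem h] at hlt
      exact hlt.not_ge dist_nonneg
    have h0 := hpos y hy
    rw [hr y hy]
    refine (dist_triangle_max y (p y) (g (p y))).trans (max_le ?_ ?_)
    · rw [dist_comm]
      nlinarith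
    · exact (hg _ hpy).le.trans (by gcongr)
  have hmix : ∀ x ∉ Z, ∀ y ∈ Z, dist (r x) (r y) ≤ L * dist x y := by
    intro x hx y hy
    have h1 := infDist_le_dist_of_mem (x := x) hy
    have h2 : (0 : ℝ) ≤ dist x y := dist_nonneg
    rw [hrZ y hy]
    refine (dist_triangle_max (r x) x y).trans (max_le ?_ (by nlinarith))
    rw [dist_comm]
    exact (hdist x hx).trans (by gcongr)
  refine ⟨r, fun y => ?_, hrZ, fun x y => ?_⟩
  · by_cases hy : y ∈ Z
    · rwa [hrZ y hy]
    · rw [hr y hy]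
      exact hgZ _
  have h0 : (0 : ℝ) ≤ dist x y := dist_nonneg
  by_cases hx : x ∈ Z
  · by_cases hy : y ∈ Z
    · rw [hrZ x hx, hrZ y hy]
      nlinarith
    · rw [dist_comm, dist_comm x]
      exact hmix y hy x hx
  by_cases hy : y ∈ Z
  · exact hmix x hx y hy
  by_cases hxy : f x = f y
  · rw [hr x hx, hr y hy, hpeq x y hxy, dist_self]
    positivity
  have h1 : infDist x Z ≤ dist x y := by
    by_contra! h
    exact hxy (ball_infDist_eq_of_mem hne (mem_ball'.2 h))
  have h2 : infDist y Z ≤ dist x y := by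
    by_contra! h
    exact hxy (ball_infDist_eq_of_mem hne (mem_ball.2 h)).symm
  refine (dist_triangle_max (r x) x (r y)).trans (max_le ?_ ?_)
  · rw [dist_comm]
    exact (hdist x hx).trans (by gcongr)
  · refine (dist_triangle_max x y (r y)).trans (max_le (by nlinarith) ?_)
    exact (hdist y hy).trans (by gcongr)

theorem TopologicalSpace.NonemptyCompacts.exists_dist_lt {X : Type*} [MetricSpace X]
    {K K' : NonemptyCompacts X} {ε : ℝ} (h : dist K K' < ε) {x : X} (hx : x ∈ K) :
    ∃ y ∈ K', dist x y < ε := by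
  rw [NonemptyCompacts.dist_eq] at h
  exact exists_dist_lt_of_hausdorffDist_lt hx h
    (hausdorffEDist_ne_top_of_nonempty_of_bounded K.nonempty K'.nonempty
      K.isCompact.isBounded K'.isCompact.isBounded)

instance TopologicalSpace.NonemptyCompacts.instIsUltrametricDist {X : Type*} [MetricSpace X]
    [IsUltrametricDist X] : IsUltrametricDist (NonemptyCompacts X) where
  dist_triangle_max K M N := by
    have key : ∀ {A B C : NonemptyCompacts X} {ε : ℝ}, dist A B < ε → dist B C < ε →
        ∀ x ∈ A, ∃ z ∈ C, dist x z ≤ ε := by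
      intro A B C ε hAB hBC x hx
      obtain ⟨y, hy, hxy⟩ := exists_dist_lt hAB hx
      obtain ⟨z, hz, hyz⟩ := exists_dist_lt hBC hy
      exact ⟨z, hz, (dist_triangle_max x y z).trans (max_lt hxy hyz).le⟩
    refine le_of_forall_gt_imp_ge_of_dense fun ε hε => ?_
    obtain ⟨h1, h2⟩ := max_lt_iff.1 hε
    rw [NonemptyCompacts.dist_eq]
    exact hausdorffDist_le_of_mem_dist (dist_nonneg.trans h1.le) (key h1 h2)
      (key (by rwa [dist_comm]) (by rwa [dist_comm]))

theorem TopologicalSpace.NonemptyCompacts.isClosed_setOf_encard_le {X : Type*} [MetricSpace X]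
    [IsUltrametricDist X] (m : ℕ) :
    IsClosed {K : NonemptyCompacts X | (K : Set X).encard ≤ m} := by
  rw [← isOpen_compl_iff, Metric.isOpen_iff]
  intro K hK
  have hlt : (m : ℕ∞) < (K : Set X).encard := not_le.1 hK
  obtain ⟨T, hTK, hT⟩ := Set.exists_subset_encard_eq (Order.add_one_le_of_lt hlt)
  have hfin : T.Finite := Set.finite_of_encard_eq_coe (k := m + 1) (by simpa using hT)
  obtain ⟨δ, hδ, hsep⟩ : ∃ δ > 0, ∀ x ∈ T, ∀ y ∈ T, dist x y < δ → x = y := by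
    by_cases hnt : T.Nontrivial
    · refine ⟨T.infsep, hfin.infsep_pos_iff_nontrivial.2 hnt, fun x hx y hy h => ?_⟩
      by_contra hne
      exact h.not_ge (Set.infsep_le_dist_of_mem hx hy hne)
    · exact ⟨1, one_pos, fun x hx y hy _ => Set.not_nontrivial_iff.1 hnt hx hy⟩
  refine ⟨δ, hδ, fun K' hK' => ?_⟩
  rw [mem_ball'] at hK'
  have hex : ∀ x : X, ∃ y, x ∈ T → y ∈ K' ∧ dist x y < δ := by
    intro x
    by_cases hx : x ∈ T
    · obtain ⟨y, hy⟩ := exists_dist_lt hK' (hTK hx)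
      exact ⟨y, fun _ => hy⟩
    · exact ⟨x, fun h => absurd h hx⟩
  choose φ hφ using hex
  have hinj : Set.InjOn φ T := by
    intro x hx y hy hxy
    have h2 := (hφ y hy).2
    rw [← hxy, dist_comm] at h2
    exact hsep x hx y hy ((dist_triangle_max x (φ x) y).trans_lt (max_lt (hφ x hx).2 h2))
  have hle : T.encard ≤ (K' : Set X).encard :=
    Set.encard_le_encard_of_injOn (fun x hx => (hφ x hx).1) hinj
  rw [hT] at hle
  exact not_le.2 ((ENat.add_one_le_iff (ENat.natCast_ne_top m)).1 hle)

/-- Theorem: in an ultrametric space `X`, for any `n > m ≥ 1` and any `L > 1`, there is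
a retraction `X(n) → X(m)` which is `L`-Lipschitz for the Hausdorff metric. -/
theorem ultrametric_lipschitz_retraction {X : Type*} [MetricSpace X]
    (hultra : ∀ x y z : X, dist x y ≤ max (dist x z) (dist y z))
    (n m : ℕ) (hm : 1 ≤ m) (hmn : m < n) (L : ℝ) (hL : 1 < L) :
    ∃ r : Set X → Set X,
      IsLipschitzRetraction (Set.univ : Set X) n m L r := by
  classical
  have : IsUltrametricDist X := ⟨fun x y z => by simpa [dist_comm] using hultra x z y⟩
  rcases isEmpty_or_nonempty X with hX | ⟨⟨x₀⟩⟩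
  · have hno : ∀ k A, ¬ MemFinSubsetSpace (Set.univ : Set X) k A :=
      fun k A hA => hX.elim hA.2.1.some
    exact ⟨id, fun A hA => (hno _ _ hA).elim, fun A _ => rfl, fun A B hA => (hno _ _ hA).elim⟩
  have hne : {K : NonemptyCompacts X | (K : Set X).encard ≤ m}.Nonempty :=
    ⟨{x₀}, by simpa using hm⟩
  obtain ⟨r, hrZ, hr, hLip⟩ := IsUltrametricDist.exists_lipschitz_retraction
    (NonemptyCompacts.isClosed_setOf_encard_le m) hne hL
  let toCompacts : ∀ A : Set X, A.Finite ∧ A.Nonempty → NonemptyCompacts X :=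
    fun A h => ⟨⟨A, h.1.isCompact⟩, h.2⟩
  let R : Set X → Set X := fun A =>
    if h : A.Finite ∧ A.Nonempty then (r (toCompacts A h) : Set X) else A
  have hR : ∀ A (h : A.Finite ∧ A.Nonempty), R A = r (toCompacts A h) := fun A h => dif_pos h
  refine ⟨R, fun A hA => ?_, fun A hA => ?_, fun A B hA hB => ?_⟩
  · rw [hR A ⟨hA.1, hA.2.1⟩]
    have hcard := hrZ (toCompacts A ⟨hA.1, hA.2.1⟩)
    obtain ⟨hfin, hle⟩ := Set.encard_le_coe_iff_finite_ncard_le.1 hcard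
    exact ⟨hfin, NonemptyCompacts.nonempty _, hle, Set.subset_univ _⟩
  · rw [hR A ⟨hA.1, hA.2.1⟩, hr]
    · rfl
    · exact Set.encard_le_coe_iff_finite_ncard_le.2 ⟨hA.1, hA.2.2.1⟩
  · have h := hLip (toCompacts A ⟨hA.1, hA.2.1⟩) (toCompacts B ⟨hB.1, hB.2.1⟩)
    rw [NonemptyCompacts.dist_eq, NonemptyCompacts.dist_eq] at h
    rwa [hR A ⟨hA.1, hA.2.1⟩, hR B ⟨hB.1, hB.2.1⟩]
end

section
/- Let (X, d) be a compact ultrametric space. For any integers n > m ≥ 1 there exists a retraction r : X(n) → X(m) that is 1-Lipschitz with respect to the Hausdorff metric. -/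
/-- A subset `Z` of an ultrametric space `(S, D)` in which every point of `S` has a nearest
point is a nonexpansive retract of `S`: send each point to a nearest point, chosen as a function
of the set of nearest points only. -/
theorem exists_nonexpansive_retraction_of_ultrametric {α : Type*} (D : α → α → ℝ) (S Z : Set α)
    (hZS : Z ⊆ S) (hsymm : ∀ a b, D a b = D b a) (hself : ∀ a, D a a = 0)
    (hsep : ∀ a ∈ Z, ∀ b ∈ Z, D a b ≤ 0 → a = b)
    (hultra : ∀ a ∈ S, ∀ b ∈ S, ∀ c ∈ S, D a c ≤ max (D a b) (D b c))
    (hnear : ∀ a ∈ S, ∃ c ∈ Z, ∀ c' ∈ Z, D a c ≤ D a c') :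
    ∃ r : α → α, (∀ a ∈ S, r a ∈ Z) ∧ (∀ a ∈ Z, r a = a) ∧
      ∀ a ∈ S, ∀ b ∈ S, D (r a) (r b) ≤ D a b := by
  classical
  let N : α → Set α := fun a => {c | c ∈ Z ∧ ∀ c' ∈ Z, D a c ≤ D a c'}
  let pick : α → Set α → α := fun a s => if h : s.Nonempty then h.some else a
  have hpick : ∀ a ∈ S, pick a (N a) ∈ N a := by
    intro a ha
    have h : (N a).Nonempty := hnear a ha
    simp only [pick, dif_pos h]
    exact h.some_mem
  have hsame : ∀ a ∈ S, ∀ b ∈ S, ∀ c ∈ N a, D a b < D a c → N a = N b := by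
    intro a ha b hb c hc hlt
    have heq : ∀ c' ∈ Z, D a c' = D b c' := by
      intro c' hc'
      have h1 := hc.2 c' hc'
      have h2 := hultra a ha b hb c' (hZS hc')
      have h3 := hultra b hb a ha c' (hZS hc')
      rw [hsymm b a] at h3
      rcases le_max_iff.1 h2 with h | h <;> rcases le_max_iff.1 h3 with h' | h' <;> linarith
    ext x
    refine and_congr_right fun hx => forall₂_congr fun c' hc' => ?_
    rw [heq x hx, heq c' hc']
  refine ⟨fun a => pick a (N a), fun a ha => (hpick a ha).1, fun a ha => ?_, fun a ha b hb => ?_⟩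
  · have h := hpick a (hZS ha)
    have h1 := h.2 a ha
    rw [hself] at h1
    exact (hsep a ha _ h.1 h1).symm
  · have hnonneg : 0 ≤ D a b := by
      have h := hultra a ha b hb a ha
      rwa [hsymm b a, max_self, hself] at h
    have hA := hpick a ha
    have hB := hpick b hb
    have hcase : N a = N b → D (pick a (N a)) (pick b (N b)) ≤ D a b := by
      intro h
      have hne : (N b).Nonempty := ⟨_, hB⟩
      simp only [h, pick, dif_pos hne, hself]
      exact hnonneg
    rcases lt_or_ge (D a b) (D a (pick a (N a))) with h | h
    · exact hcase (hsame a ha b hb _ hA h)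
    rcases lt_or_ge (D a b) (D b (pick b (N b))) with h' | h'
    · rw [hsymm a b] at h'
      exact hcase (hsame b hb a ha _ hB h').symm
    have h1 := hultra _ (hZS hA.1) a ha _ (hZS hB.1)
    have h2 := hultra a ha b hb _ (hZS hB.1)
    rw [hsymm _ a] at h1
    exact h1.trans (max_le h (h2.trans (max_le le_rfl h')))

/-- The Hausdorff distance on the nonempty subsets of a bounded ultrametric space satisfies the
strong triangle inequality. -/
theorem hausdorffDist_le_max_of_ultrametric {X : Type*} [MetricSpace X] [BoundedSpace X]
    (hultra : ∀ x y z : X, dist x y ≤ max (dist x z) (dist y z))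
    {A B C : Set X} (hA : A.Nonempty) (hB : B.Nonempty) (hC : C.Nonempty) :
    Metric.hausdorffDist A C ≤ max (Metric.hausdorffDist A B) (Metric.hausdorffDist B C) := by
  have hfin : ∀ {S T : Set X}, S.Nonempty → T.Nonempty → Metric.hausdorffEDist S T ≠ ⊤ :=
    fun hS hT => Metric.hausdorffEDist_ne_top_of_nonempty_of_bounded hS hT
      (Bornology.IsBounded.all _) (Bornology.IsBounded.all _)
  refine le_of_forall_gt_imp_ge_of_dense fun ε hε => ?_
  obtain ⟨h1, h2⟩ := max_lt_iff.1 hε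
  refine Metric.hausdorffDist_le_of_mem_dist (Metric.hausdorffDist_nonneg.trans h1.le) ?_ ?_
  · intro x hx
    obtain ⟨y, hy, hxy⟩ := Metric.exists_dist_lt_of_hausdorffDist_lt hx h1 (hfin hA hB)
    obtain ⟨z, hz, hyz⟩ := Metric.exists_dist_lt_of_hausdorffDist_lt hy h2 (hfin hB hC)
    rw [dist_comm] at hyz
    exact ⟨z, hz, (hultra x z y).trans (max_le hxy.le hyz.le)⟩
  · intro z hz
    obtain ⟨y, hy, hyz⟩ := Metric.exists_dist_lt_of_hausdorffDist_lt' hz h2 (hfin hB hC)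
    obtain ⟨x, hx, hxy⟩ := Metric.exists_dist_lt_of_hausdorffDist_lt' hy h1 (hfin hA hB)
    rw [dist_comm] at hyz
    exact ⟨x, hx, (hultra z x y).trans (max_le hyz.le hxy.le)⟩

theorem memFinSubsetSpace_univ_iff_exists_range {X : Type*} {m : ℕ} (hm : 1 ≤ m) {C : Set X} :
    MemFinSubsetSpace Set.univ m C ↔ ∃ f : Fin m → X, Set.range f = C := by
  constructor
  · rintro ⟨hfin, ⟨x₀, hx₀⟩, hcard, -⟩
    have : Finite C := hfin
    have : Nonempty C := ⟨⟨x₀, hx₀⟩⟩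
    have e : C ≃ Fin C.ncard := Finite.equivFinOfCardEq rfl
    let i : C → Fin m := fun x => Fin.castLE hcard (e x)
    have hi : Function.Injective i := (Fin.castLE_injective hcard).comp e.injective
    refine ⟨Subtype.val ∘ Function.invFun i, ?_⟩
    have hsurj : Function.Surjective (Function.invFun i) := Function.invFun_surjective hi
    rw [hsurj.range_comp, Subtype.range_coe]
  · rintro ⟨f, rfl⟩
    refine ⟨Set.finite_range f, ⟨f ⟨0, hm⟩, Set.mem_range_self _⟩, ?_, Set.subset_univ _⟩
    simpa [Set.image_univ, Set.ncard_univ] using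
      Set.ncard_image_le (f := f) (s := Set.univ) Set.finite_univ

/-- In a compact metric space, every nonempty set has a nearest point in `X(m)`. -/
theorem exists_nearest_memFinSubsetSpace {X : Type*} [MetricSpace X] [CompactSpace X]
    {m : ℕ} (hm : 1 ≤ m) {A : Set X} (hA : A.Nonempty) :
    ∃ C, MemFinSubsetSpace Set.univ m C ∧ ∀ C', MemFinSubsetSpace Set.univ m C' →
      Metric.hausdorffDist A C ≤ Metric.hausdorffDist A C' := by
  have : Nonempty X := ⟨hA.some⟩
  have : Nonempty (Fin m) := ⟨⟨0, hm⟩⟩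
  have hrange : ∀ f g : Fin m → X,
      Metric.hausdorffDist (Set.range f) (Set.range g) ≤ dist f g := by
    intro f g
    refine Metric.hausdorffDist_le_of_mem_dist dist_nonneg ?_ ?_
    · rintro _ ⟨k, rfl⟩
      exact ⟨g k, Set.mem_range_self k, dist_le_pi_dist f g k⟩
    · rintro _ ⟨k, rfl⟩
      exact ⟨f k, Set.mem_range_self k, dist_comm (g k) (f k) ▸ dist_le_pi_dist f g k⟩
  have hlip : LipschitzWith 1 fun f : Fin m → X => Metric.hausdorffDist A (Set.range f) := by
    refine LipschitzWith.of_le_add fun f g => ?_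
    have h := Metric.hausdorffDist_triangle (s := A) (t := Set.range g) (u := Set.range f)
      (Metric.hausdorffEDist_ne_top_of_nonempty_of_bounded hA (Set.range_nonempty g)
        (Bornology.IsBounded.all _) (Bornology.IsBounded.all _))
    have h' := hrange g f
    rw [dist_comm] at h'
    linarith
  obtain ⟨f, -, hf⟩ := isCompact_univ.exists_isMinOn Set.univ_nonempty hlip.continuous.continuousOn
  refine ⟨Set.range f, (memFinSubsetSpace_univ_iff_exists_range hm).2 ⟨f, rfl⟩, fun C' hC' => ?_⟩
  obtain ⟨g, rfl⟩ := (memFinSubsetSpace_univ_iff_exists_range hm).1 hC'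
  exact hf (Set.mem_univ g)

/-- Theorem: in a compact ultrametric space `X`, for any `n > m ≥ 1` there is a
retraction `X(n) → X(m)` which is `1`-Lipschitz for the Hausdorff metric. -/
theorem compact_ultrametric_one_lipschitz_retraction {X : Type*} [MetricSpace X]
    [CompactSpace X]
    (hultra : ∀ x y z : X, dist x y ≤ max (dist x z) (dist y z))
    (n m : ℕ) (hm : 1 ≤ m) (hmn : m < n) :
    ∃ r : Set X → Set X,
      IsLipschitzRetraction (Set.univ : Set X) n m 1 r := by
  obtain ⟨r, h1, h2, h3⟩ := exists_nonexpansive_retraction_of_ultrametric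
    (Metric.hausdorffDist : Set X → Set X → ℝ)
    {A | MemFinSubsetSpace Set.univ n A} {A | MemFinSubsetSpace Set.univ m A}
    (fun A hA => ⟨hA.1, hA.2.1, hA.2.2.1.trans hmn.le, hA.2.2.2⟩)
    (fun _ _ => Metric.hausdorffDist_comm) (fun _ => Metric.hausdorffDist_self_zero)
    (fun A hA B hB h => (hA.1.isClosed.hausdorffDist_zero_iff_eq hB.1.isClosed
      (Metric.hausdorffEDist_ne_top_of_nonempty_of_bounded hA.2.1 hB.2.1
        hA.1.isBounded hB.1.isBounded)).1 (le_antisymm h Metric.hausdorffDist_nonneg))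
    (fun A hA B hB C hC => hausdorffDist_le_max_of_ultrametric hultra hA.2.1 hB.2.1 hC.2.1)
    (fun A hA => exists_nearest_memFinSubsetSpace hm hA.2.1)
  refine ⟨r, h1, h2, fun A B hA hB => ?_⟩
  rw [one_mul]
  exact h3 A hA B hB
end

section
/- Let (X, d) be a metric space. Suppose there exist constants L ≥ 1 and b ∈ (0,1) and a family of L-Lipschitz maps τ_k : X → X, indexed by k ∈ ℤ, such that for every x, y ∈ X and every k ∈ ℤ: (i) d(τ_k(x), x) ≤ L·b^k, and (ii) either τ_k(x) = τ_k(y) or d(τ_k(x), τ_k(y)) ≥ L^{-1}·b^k. Then for any integers n > m ≥ 1 there exists a retraction r : X(n) → X(m) that is (2L³b^{-1} + 1)-Lipschitz with respect to the Hausdorff metric. -/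
/-- `k` is the least index at which the image of `A` under `τ k` has more than `m` points. -/
def IsCriticalScale {X : Type*} (τ : ℤ → X → X) (m : ℕ) (A : Set X) (k : ℤ) : Prop :=
  m < (τ k '' A).ncard ∧ ∀ j < k, (τ j '' A).ncard ≤ m

/-- If the values of `f` are equal or `c`-separated, then `f` has the same image on sets whose
Hausdorff distance is small compared to `c`. -/
theorem image_eq_of_hausdorffDist_lt {X : Type*} [MetricSpace X] {f : X → X} {L c : ℝ}
    (hL : 0 < L) (hlip : ∀ x y, dist (f x) (f y) ≤ L * dist x y)
    (hsep : ∀ x y, f x = f y ∨ c ≤ dist (f x) (f y)) {A B : Set X}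
    (hAB : Metric.hausdorffEDist A B ≠ ⊤) (h : L * Metric.hausdorffDist A B < c) :
    f '' A = f '' B := by
  have key : ∀ x y, dist x y < c / L → f x = f y := fun x y hxy ↦ by
    refine (hsep x y).resolve_right (not_le.2 ((hlip x y).trans_lt ?_))
    rwa [lt_div_iff₀' hL] at hxy
  have h' : Metric.hausdorffDist A B < c / L := by rwa [lt_div_iff₀' hL]
  apply Set.Subset.antisymm
  · rintro _ ⟨x, hx, rfl⟩
    obtain ⟨y, hy, hxy⟩ := Metric.exists_dist_lt_of_hausdorffDist_lt hx h' hAB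
    exact ⟨y, hy, (key x y hxy).symm⟩
  · rintro _ ⟨y, hy, rfl⟩
    obtain ⟨x, hx, hxy⟩ := Metric.exists_dist_lt_of_hausdorffDist_lt' hy h' hAB
    exact ⟨x, hx, key x y hxy⟩

/-- A map moving points by at most `c` moves sets by at most `c` in the Hausdorff distance. -/
theorem hausdorffDist_image_self_le {X : Type*} [MetricSpace X] {f : X → X} {c : ℝ}
    (hc : 0 ≤ c) (hf : ∀ x, dist (f x) x ≤ c) (A : Set X) :
    Metric.hausdorffDist (f '' A) A ≤ c := by
  refine Metric.hausdorffDist_le_of_mem_dist hc ?_ fun x hx ↦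
    ⟨f x, ⟨x, hx, rfl⟩, by simpa [dist_comm] using hf x⟩
  rintro _ ⟨x, hx, rfl⟩
  exact ⟨x, hx, hf x⟩

/-- Finite sets with more than `m ≥ 1` points have a critical scale. -/
theorem exists_isCriticalScale {X : Type*} [MetricSpace X] {L b : ℝ} (hL : 1 ≤ L) (hb0 : 0 < b)
    (hb1 : b < 1) {τ : ℤ → X → X}
    (hlip : ∀ (k : ℤ) (x y : X), dist (τ k x) (τ k y) ≤ L * dist x y)
    (hdisp : ∀ (k : ℤ) (x : X), dist (τ k x) x ≤ L * b ^ k)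
    (hsep : ∀ (k : ℤ) (x y : X), τ k x = τ k y ∨ L⁻¹ * b ^ k ≤ dist (τ k x) (τ k y))
    {m : ℕ} (hm : 1 ≤ m) {A : Set X} (hA : A.Finite) (hmA : m < A.ncard) :
    ∃ k, IsCriticalScale τ m A k := by
  have hL0 : 0 < L := by linarith
  have hfine : ∃ k : ℤ, m < (τ k '' A).ncard := by
    obtain ⟨ε, hε, hAε⟩ : ∃ ε > 0, ∀ x ∈ A, ∀ y ∈ A, x ≠ y → ε ≤ dist x y := by
      by_cases hs : A.Subsingleton
      · exact ⟨1, one_pos, fun x hx y hy h ↦ (h (hs hx hy)).elim⟩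
      · have hnt : A.Nontrivial := Set.not_subsingleton_iff.1 hs
        exact ⟨A.infsep, hA.infsep_pos_iff_nontrivial.2 hnt, fun x hx y hy h ↦
          Set.infsep_le_dist_of_mem hx hy h⟩
    obtain ⟨N, hN⟩ := exists_pow_lt_of_lt_one (show 0 < ε / (2 * L) by positivity) hb1
    refine ⟨N, ?_⟩
    refine hmA.trans_eq (Set.InjOn.ncard_image fun x hx y hy hxy ↦ ?_).symm
    by_contra hne
    have h1 := hdisp N x
    have h2 := hdisp N y
    have h3 := dist_triangle_left x y (τ N x)
    rw [← hxy] at h2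
    rw [zpow_natCast] at h1 h2
    rw [lt_div_iff₀ (by positivity)] at hN
    linarith [hAε x hx y hy hne]
  have hcoarse : ∃ N : ℤ, ∀ k : ℤ, m < (τ k '' A).ncard → N ≤ k := by
    obtain ⟨N, hN⟩ := pow_unbounded_of_one_lt (L * (L * Metric.diam A))
      ((one_lt_inv₀ hb0).2 hb1)
    refine ⟨-N, fun k hk ↦ ?_⟩
    by_contra! hkN
    have hsub : (τ k '' A).Subsingleton := by
      rintro _ ⟨x, hx, rfl⟩ _ ⟨y, hy, rfl⟩
      refine (hsep k x y).resolve_right (not_le.2 ?_)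
      have h1 : b ^ (-N : ℤ) ≤ b ^ k := zpow_le_zpow_right_of_le_one₀ hb0 hb1.le hkN.le
      rw [zpow_neg, zpow_natCast, ← inv_pow] at h1
      have h2 : L * dist x y ≤ L * Metric.diam A :=
        mul_le_mul_of_nonneg_left (Metric.dist_le_diam_of_mem hA.isBounded hx hy) hL0.le
      rw [inv_mul_eq_div, lt_div_iff₀' hL0]
      calc L * dist (τ k x) (τ k y) ≤ L * (L * Metric.diam A) :=
            mul_le_mul_of_nonneg_left ((hlip k x y).trans h2) hL0.le
        _ < b ^ k := hN.trans_le h1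
    have := (Set.ncard_le_one (hA.image (τ k))).2 fun x hx y hy ↦ hsub hx hy
    omega
  obtain ⟨k, hk, hmin⟩ := Int.exists_least_of_bdd hcoarse hfine
  exact ⟨k, hk, fun j hj ↦ by by_contra! h; exact absurd (hmin j h) (by omega)⟩

open Classical in
/-- The image of `A` at the scale just coarser than the critical one, or `A` itself if no scale is
critical. -/
noncomputable def coarsen {X : Type*} (τ : ℤ → X → X) (m : ℕ) (A : Set X) : Set X :=
  if h : ∃ k, IsCriticalScale τ m A k then τ (h.choose - 1) '' A else A

theorem IsCriticalScale.unique {X : Type*} {τ : ℤ → X → X} {m : ℕ} {A : Set X} {k l : ℤ}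
    (hk : IsCriticalScale τ m A k) (hl : IsCriticalScale τ m A l) : k = l := by
  rcases lt_trichotomy k l with h | h | h
  · exact absurd hk.1 (not_lt.2 (hl.2 k h))
  · exact h
  · exact absurd hl.1 (not_lt.2 (hk.2 l h))

theorem IsCriticalScale.coarsen_eq {X : Type*} {τ : ℤ → X → X} {m : ℕ} {A : Set X} {k : ℤ}
    (hk : IsCriticalScale τ m A k) : coarsen τ m A = τ (k - 1) '' A := by
  have h : ∃ k, IsCriticalScale τ m A k := ⟨k, hk⟩
  rw [coarsen, dif_pos h, h.choose_spec.unique hk]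

theorem coarsen_eq_self {X : Type*} {τ : ℤ → X → X} {m : ℕ} {A : Set X} (hA : A.Finite)
    (hmA : A.ncard ≤ m) : coarsen τ m A = A :=
  dif_neg fun ⟨_, hk⟩ ↦ absurd hk.1 (not_lt.2 ((Set.ncard_image_le hA).trans hmA))

/-- Theorem (Proposition 2.2): if a metric space `X` carries a family of `L`-Lipschitz
maps `τ_k : X → X`, `k ∈ ℤ`, with `d(τ_k x, x) ≤ L b^k` and with the values of `τ_k`
either equal or `L⁻¹ b^k`-separated, then for any `n > m ≥ 1` there is a retraction
`X(n) → X(m)` which is `(2 L³ b⁻¹ + 1)`-Lipschitz for the Hausdorff metric. -/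
theorem retraction_from_discretization {X : Type*} [MetricSpace X]
    (L b : ℝ) (hL : 1 ≤ L) (hb0 : 0 < b) (hb1 : b < 1)
    (τ : ℤ → X → X)
    (hlip : ∀ (k : ℤ) (x y : X), dist (τ k x) (τ k y) ≤ L * dist x y)
    (hdisp : ∀ (k : ℤ) (x : X), dist (τ k x) x ≤ L * b ^ k)
    (hsep : ∀ (k : ℤ) (x y : X), τ k x = τ k y ∨ L⁻¹ * b ^ k ≤ dist (τ k x) (τ k y))
    (n m : ℕ) (hm : 1 ≤ m) (hmn : m < n) :
    ∃ r : Set X → Set X,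
      IsLipschitzRetraction (Set.univ : Set X) n m (2 * L ^ 3 * b⁻¹ + 1) r := by
  have hL0 : 0 < L := by linarith
  have hpos : ∀ k : ℤ, 0 < b ^ k := fun k ↦ zpow_pos hb0 k
  have hcrit : ∀ {A : Set X}, A.Finite → m < A.ncard → ∃ k, IsCriticalScale τ m A k :=
    exists_isCriticalScale hL hb0 hb1 hlip hdisp hsep hm
  have hfin : ∀ {A B : Set X}, A.Finite → A.Nonempty → B.Finite → B.Nonempty →
      Metric.hausdorffEDist A B ≠ ⊤ := fun hA hA' hB hB' ↦
    Metric.hausdorffEDist_ne_top_of_nonempty_of_bounded hA' hB' hA.isBounded hB.isBounded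
  have hscale : ∀ {A B : Set X} (k : ℤ), Metric.hausdorffEDist A B ≠ ⊤ →
      τ k '' A ≠ τ k '' B → b ^ k ≤ L ^ 2 * Metric.hausdorffDist A B := by
    intro A B k hAB hne
    by_contra! h
    refine hne (image_eq_of_hausdorffDist_lt hL0 (hlip k) (hsep k) hAB ?_)
    rw [inv_mul_eq_div, lt_div_iff₀' hL0]
    linarith
  have hmove : ∀ (k : ℤ) (A : Set X), Metric.hausdorffDist (τ k '' A) A ≤ L * b ^ k := fun k A ↦
    hausdorffDist_image_self_le (mul_pos hL0 (hpos k)).le (hdisp k) A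
  have hprev : ∀ {k : ℤ} {δ : ℝ}, b ^ k ≤ L ^ 2 * δ → L * b ^ (k - 1) ≤ L ^ 3 * b⁻¹ * δ := by
    intro k δ h
    rw [zpow_sub_one₀ hb0.ne']
    calc L * (b ^ k * b⁻¹) = (L * b⁻¹) * b ^ k := by ring
      _ ≤ (L * b⁻¹) * (L ^ 2 * δ) := by gcongr
      _ = L ^ 3 * b⁻¹ * δ := by ring
  have hmixed : ∀ {A B : Set X}, A.Finite → A.Nonempty → B.Finite → B.Nonempty →
      A.ncard ≤ m → m < B.ncard → Metric.hausdorffDist (coarsen τ m A) (coarsen τ m B) ≤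
        (2 * L ^ 3 * b⁻¹ + 1) * Metric.hausdorffDist A B := by
    intro A B hA hA' hB hB' hmA hmB
    obtain ⟨l, hl⟩ := hcrit hB hmB
    rw [coarsen_eq_self hA hmA, hl.coarsen_eq]
    have hne : τ l '' A ≠ τ l '' B := fun h ↦
      absurd hl.1 (not_lt.2 (h ▸ (Set.ncard_image_le hA).trans hmA))
    have h1 := hprev (hscale l (hfin hA hA' hB hB') hne)
    have h2 := Metric.hausdorffDist_triangle (u := τ (l - 1) '' B) (hfin hA hA' hB hB')
    have h3 := hmove (l - 1) B
    rw [Metric.hausdorffDist_comm] at h3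
    have h4 := mul_pos hL0 (hpos (l - 1))
    linarith
  have hboth : ∀ {A B : Set X} {k l : ℤ}, A.Finite → A.Nonempty → B.Finite → B.Nonempty →
      IsCriticalScale τ m A k → IsCriticalScale τ m B l → k ≤ l →
      Metric.hausdorffDist (coarsen τ m A) (coarsen τ m B) ≤
        (2 * L ^ 3 * b⁻¹ + 1) * Metric.hausdorffDist A B := by
    intro A B k l hA hA' hB hB' hk hl hkl
    have hAB := hfin hA hA' hB hB'
    have hδ : 0 ≤ Metric.hausdorffDist A B := Metric.hausdorffDist_nonneg
    rw [hk.coarsen_eq, hl.coarsen_eq]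
    by_cases heq : τ (k - 1) '' A = τ (l - 1) '' B
    · rw [heq, Metric.hausdorffDist_self_zero]
      positivity
    have h0 : b ^ k ≤ L ^ 2 * Metric.hausdorffDist A B := by
      rcases hkl.lt_or_eq with hlt | rfl
      · refine hscale k hAB fun h ↦ absurd hk.1 (not_lt.2 (h ▸ hl.2 k hlt))
      · exact (zpow_le_zpow_right_of_le_one₀ hb0 hb1.le (by omega)).trans
          (hscale (k - 1) hAB heq)
    have h1 := hprev h0
    have h2 : L * b ^ (l - 1) ≤ L * b ^ (k - 1) := by
      gcongr L * ?_
      exact zpow_le_zpow_right_of_le_one₀ hb0 hb1.le (by omega)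
    have h3 := Metric.hausdorffDist_triangle (u := τ (l - 1) '' B)
      (hfin (hA.image (τ (k - 1))) (hA'.image _) hA hA')
    have h4 := Metric.hausdorffDist_triangle (u := τ (l - 1) '' B) hAB
    have h5 := hmove (l - 1) B
    rw [Metric.hausdorffDist_comm] at h5
    linarith [hmove (k - 1) A]
  refine ⟨coarsen τ m, ?_, fun A hA ↦ coarsen_eq_self hA.1 hA.2.2.1, ?_⟩
  · rintro A ⟨hA, hA', -, -⟩
    rcases le_or_gt A.ncard m with hmA | hmA
    · rw [coarsen_eq_self hA hmA]
      exact ⟨hA, hA', hmA, Set.subset_univ _⟩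
    · obtain ⟨k, hk⟩ := hcrit hA hmA
      rw [hk.coarsen_eq]
      exact ⟨hA.image _, hA'.image _, hk.2 _ (by omega), Set.subset_univ _⟩
  · rintro A B ⟨hA, hA', -, -⟩ ⟨hB, hB', -, -⟩
    rcases le_or_gt A.ncard m with hmA | hmA <;> rcases le_or_gt B.ncard m with hmB | hmB
    · rw [coarsen_eq_self hA hmA, coarsen_eq_self hB hmB]
      refine le_mul_of_one_le_left Metric.hausdorffDist_nonneg ?_
      have : 0 ≤ 2 * L ^ 3 * b⁻¹ := by positivity
      linarith
    · exact hmixed hA hA' hB hB' hmA hmB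
    · rw [Metric.hausdorffDist_comm, Metric.hausdorffDist_comm (s := A)]
      exact hmixed hB hB' hA hA' hmB hmA
    · obtain ⟨k, hk⟩ := hcrit hA hmA
      obtain ⟨l, hl⟩ := hcrit hB hmB
      rcases le_total k l with h | h
      · exact hboth hA hA' hB hB' hk hl h
      · rw [Metric.hausdorffDist_comm, Metric.hausdorffDist_comm (s := A)]
        exact hboth hB hB' hA hA' hl hk h
end

section
/- Let (X, d) be a uniformly disconnected metric space. Then there exists a constant L ≥ 1 such that for all integers n > m ≥ 1 there exists an L-Lipschitz retraction r : X(n) → X(m) (with L independent of n and m). -/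
/-- A metric space is uniformly disconnected if there is `c > 0` such that for every
finite chain `x_0, x_1, …, x_N` one has `max_{1 ≤ k ≤ N} d(x_k, x_{k-1}) ≥ c d(x_0, x_N)`. -/
def UniformlyDisconnected (X : Type*) [MetricSpace X] : Prop :=
  ∃ c : ℝ, 0 < c ∧ ∀ (N : ℕ) (x : ℕ → X), 1 ≤ N →
    ∃ k : ℕ, 1 ≤ k ∧ k ≤ N ∧ c * dist (x 0) (x N) ≤ dist (x k) (x (k - 1))

open Metric

theorem Relation.ReflTransGen.exists_seq {X : Type*} {R : X → X → Prop} {a b : X}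
    (h : Relation.ReflTransGen R a b) :
    ∃ (N : ℕ) (f : ℕ → X), f 0 = a ∧ f N = b ∧ ∀ k < N, R (f k) (f (k + 1)) := by
  induction h with
  | refl => exact ⟨0, fun _ => a, rfl, rfl, by simp⟩
  | @tail b d _ hbd ih =>
    obtain ⟨N, f, h0, hN, hf⟩ := ih
    refine ⟨N + 1, fun i => if i ≤ N then f i else d, by simpa using h0, by simp, ?_⟩
    intro k hk
    rcases Nat.lt_succ_iff_lt_or_eq.1 hk with hk | rfl
    · simpa [hk.le, Nat.succ_le_of_lt hk] using hf k hk
    · simpa [hN] using hbd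

/-- The equivalence relation of being joined by a chain with steps of length at most `t`. -/
def chainSetoid (X : Type*) [MetricSpace X] (t : ℝ) : Setoid X where
  r := Relation.ReflTransGen fun x y => dist x y ≤ t
  iseqv :=
    { refl := fun _ => Relation.ReflTransGen.refl
      symm := fun h => by
        have : Std.Symm fun x y : X => dist x y ≤ t := ⟨fun x y h => by rwa [dist_comm]⟩
        exact symm h
      trans := fun h₁ h₂ => h₁.trans h₂ }

/-- A system of compatible centres for the pieces of a metric space at the scales `2 ^ k`:
points at distance at most `2 ^ k` have the same centre, the pieces get coarser as `k` grows,
and points with the same centre are at distance at most `2 ^ k / c`. -/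
structure IsCentreSystem {X : Type*} [MetricSpace X] (c : ℝ) (p : ℤ → X → X) : Prop where
  eq_of_dist_le : ∀ k x y, dist x y ≤ 2 ^ k → p k x = p k y
  comp : ∀ j k x, j ≤ k → p k (p j x) = p k x
  dist_le : ∀ k x y, p k x = p k y → c * dist x y ≤ 2 ^ k

theorem exists_isCentreSystem {X : Type*} [MetricSpace X] {c : ℝ}
    (hud : ∀ (N : ℕ) (x : ℕ → X), 1 ≤ N →
      ∃ k : ℕ, 1 ≤ k ∧ k ≤ N ∧ c * dist (x 0) (x N) ≤ dist (x k) (x (k - 1))) :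
    ∃ p : ℤ → X → X, IsCentreSystem c p := by
  have out_rel : ∀ (k : ℤ) (x : X),
      chainSetoid X (2 ^ k) (Quotient.mk (chainSetoid X (2 ^ k)) x).out x :=
    fun k x => Quotient.exact (Quotient.out_eq _)
  refine ⟨fun k x => (Quotient.mk (chainSetoid X (2 ^ k)) x).out, ?_, ?_, ?_⟩
  · intro k x y h
    exact congrArg Quotient.out (Quotient.sound (Relation.ReflTransGen.single h))
  · intro j k x hjk
    refine congrArg Quotient.out (Quotient.sound ?_)
    exact Relation.ReflTransGen.mono
      (fun a b hab => hab.trans (zpow_le_zpow_right₀ one_le_two hjk)) _ _ (out_rel j x)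
  · intro k x y h
    have hxy : chainSetoid X (2 ^ k) x y :=
      Quotient.exact (Quotient.out_injective h)
    obtain ⟨N, f, rfl, rfl, hf⟩ := Relation.ReflTransGen.exists_seq hxy
    rcases Nat.eq_zero_or_pos N with rfl | hN
    · simp only [dist_self, mul_zero]; positivity
    · obtain ⟨i, hi, hiN, h⟩ := hud N f hN
      obtain ⟨i, rfl⟩ := Nat.exists_eq_add_of_le' hi
      refine h.trans ?_
      rw [dist_comm]
      exact hf i hiN

namespace IsCentreSystem

variable {X : Type*} [MetricSpace X] {c : ℝ} {p : ℤ → X → X}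

theorem ncard_image_anti (hp : IsCentreSystem c p) {A : Set X} (hA : A.Finite) {j k : ℤ}
    (hjk : j ≤ k) : (p k '' A).ncard ≤ (p j '' A).ncard := by
  have : p k '' A = p k '' (p j '' A) := by
    rw [Set.image_image]
    exact Set.image_congr fun x _ => (hp.comp j k x hjk).symm
  rw [this]
  exact Set.ncard_image_le (hA.image _)

theorem exists_ncard_image_le_one (hp : IsCentreSystem c p) {A : Set X} (hA : A.Finite) :
    ∃ k, (p k '' A).ncard ≤ 1 := by
  obtain ⟨n, hn⟩ := pow_unbounded_of_one_lt (diam A) (one_lt_two (α := ℝ))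
  refine ⟨n, (Set.ncard_le_one (hA.image _)).2 ?_⟩
  rintro _ ⟨x, hx, rfl⟩ _ ⟨y, hy, rfl⟩
  refine hp.eq_of_dist_le _ _ _ ((dist_le_diam_of_mem hA.isBounded hx hy).trans ?_)
  exact_mod_cast hn.le

theorem exists_injOn (hp : IsCentreSystem c p) (hc : 0 < c) {A : Set X} (hA : A.Finite) :
    ∃ k, Set.InjOn (p k) A := by
  have hA' : (A.offDiag).Finite := hA.offDiag
  obtain ⟨ε, hε, h⟩ : ∃ ε : ℝ, 0 < ε ∧ ∀ q ∈ A.offDiag, ε < c * dist q.1 q.2 := by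
    have hev : ∀ᶠ ε : ℝ in nhdsWithin 0 (Set.Ioi 0), ∀ q ∈ A.offDiag, ε < c * dist q.1 q.2 := by
      refine (Filter.eventually_all_finite hA').2 fun q hq => ?_
      exact nhdsWithin_le_nhds (gt_mem_nhds (mul_pos hc (dist_pos.2 hq.2.2)))
    obtain ⟨ε, h, hε⟩ := (hev.and self_mem_nhdsWithin).exists
    exact ⟨ε, hε, h⟩
  obtain ⟨k, hk, -⟩ := exists_mem_Ico_zpow hε (one_lt_two (α := ℝ))
  refine ⟨k, fun x hx y hy hxy => ?_⟩
  by_contra hne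
  exact absurd (hp.dist_le k x y hxy) (not_le.2 (hk.trans_lt (h (x, y) ⟨hx, hy, hne⟩)))

theorem exists_least_scale (hp : IsCentreSystem c p) (hc : 0 < c) {m : ℕ} (hm : 1 ≤ m)
    {A : Set X} (hA : A.Finite) (hmA : m < A.ncard) :
    ∃ k, (p k '' A).ncard ≤ m ∧ ∀ j, (p j '' A).ncard ≤ m → k ≤ j := by
  refine Int.exists_least_of_bdd ?_ ?_
  · obtain ⟨k, hk⟩ := hp.exists_injOn hc hA
    refine ⟨k, fun j hj => ?_⟩
    by_contra! hjk
    have := hp.ncard_image_anti hA hjk.le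
    rw [hk.ncard_image] at this
    omega
  · obtain ⟨k, hk⟩ := hp.exists_ncard_image_le_one hA
    exact ⟨k, hk.trans hm⟩

theorem image_subset_image (hp : IsCentreSystem c p) {A B : Set X} (hA : A.Finite)
    (hB : B.Finite) (hA' : A.Nonempty) (hB' : B.Nonempty) {k : ℤ}
    (h : hausdorffDist A B ≤ 2 ^ k) : p k '' A ⊆ p k '' B := by
  rintro _ ⟨x, hx, rfl⟩
  obtain ⟨y, hy, hxy⟩ := hB.isCompact.exists_infDist_eq_dist hB' x
  refine ⟨y, hy, (hp.eq_of_dist_le _ _ _ ?_).symm⟩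
  rw [← hxy]
  exact (infDist_le_hausdorffDist_of_mem hx
    (hausdorffEDist_ne_top_of_nonempty_of_bounded hA' hB' hA.isBounded hB.isBounded)).trans h

theorem image_eq_image (hp : IsCentreSystem c p) {A B : Set X} (hA : A.Finite)
    (hB : B.Finite) (hA' : A.Nonempty) (hB' : B.Nonempty) {k : ℤ}
    (h : hausdorffDist A B ≤ 2 ^ k) : p k '' A = p k '' B :=
  (hp.image_subset_image hA hB hA' hB' h).antisymm
    (hp.image_subset_image hB hA hB' hA' (by rwa [hausdorffDist_comm]))

theorem hausdorffDist_image_le (hp : IsCentreSystem c p) (hc : 0 < c) (A : Set X) (k : ℤ) :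
    hausdorffDist A (p k '' A) ≤ 2 ^ k / c := by
  have key : ∀ x, dist x (p k x) ≤ 2 ^ k / c := fun x => by
    rw [le_div_iff₀' hc]
    exact hp.dist_le k _ _ (hp.comp k k x le_rfl).symm
  refine hausdorffDist_le_of_mem_dist (by positivity) (fun x hx => ⟨p k x, ⟨x, hx, rfl⟩, key x⟩) ?_
  rintro _ ⟨x, hx, rfl⟩
  exact ⟨x, hx, by rw [dist_comm]; exact key x⟩

/-- If the least scale for `A` exceeds the scale of the Hausdorff distance from `A` to `B`,
then it is the least scale for `B` as well. -/
theorem least_scale_transfer (hp : IsCentreSystem c p) {A B : Set X} (hA : A.Finite)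
    (hB : B.Finite) (hA' : A.Nonempty) (hB' : B.Nonempty) {m : ℕ} {K k : ℤ}
    (h : hausdorffDist A B ≤ 2 ^ K) (hK : K < k) (hk : (p k '' A).ncard ≤ m)
    (hmin : ∀ j, (p j '' A).ncard ≤ m → k ≤ j) :
    p k '' A = p k '' B ∧ m < B.ncard ∧ (p k '' B).ncard ≤ m ∧
      ∀ j, (p j '' B).ncard ≤ m → k ≤ j := by
  have heq : ∀ j, K ≤ j → p j '' A = p j '' B := fun j hj =>
    hp.image_eq_image hA hB hA' hB' (h.trans (zpow_le_zpow_right₀ one_le_two hj))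
  have hKB : m < (p K '' B).ncard := by
    rw [← heq K le_rfl]
    by_contra! hle
    exact absurd (hmin K hle) (not_le.2 hK)
  refine ⟨heq k hK.le, hKB.trans_le (Set.ncard_image_le hB), heq k hK.le ▸ hk, fun j hj => ?_⟩
  rcases le_or_gt K j with hKj | hKj
  · exact hmin j (by rwa [heq j hKj])
  · exact absurd (hp.ncard_image_anti hB hKj.le) (by omega)

theorem exists_isLipschitzRetraction (hp : IsCentreSystem c p) (hc : 0 < c) {n m : ℕ}
    (hm : 1 ≤ m) : ∃ r : Set X → Set X,
      IsLipschitzRetraction (Set.univ : Set X) n m (1 + 4 / c) r := by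
  classical
  have hex : ∀ A : Set X, ∃ k, A.Finite → m < A.ncard →
      (p k '' A).ncard ≤ m ∧ ∀ j, (p j '' A).ncard ≤ m → k ≤ j := by
    intro A
    by_cases h : A.Finite ∧ m < A.ncard
    · obtain ⟨k, hk⟩ := hp.exists_least_scale hc hm h.1 h.2
      exact ⟨k, fun _ _ => hk⟩
    · exact ⟨0, fun h₁ h₂ => absurd ⟨h₁, h₂⟩ h⟩
  choose s hs using hex
  let r : Set X → Set X := fun A => if A.ncard ≤ m then A else p (s A) '' A
  have r_small : ∀ A : Set X, A.ncard ≤ m → r A = A := fun A h => if_pos h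
  have r_large : ∀ A : Set X, m < A.ncard → r A = p (s A) '' A := fun A h => if_neg h.not_ge
  have r_mem : ∀ A : Set X, A.Finite → A.Nonempty → MemFinSubsetSpace Set.univ m (r A) := by
    intro A hA hA'
    rcases le_or_gt A.ncard m with h | h
    · rw [r_small A h]; exact ⟨hA, hA', h, Set.subset_univ _⟩
    · rw [r_large A h]; exact ⟨hA.image _, hA'.image _, (hs A hA h).1, Set.subset_univ _⟩
  have r_eq : ∀ (A B : Set X) (K : ℤ), A.Finite → B.Finite → A.Nonempty → B.Nonempty →
      hausdorffDist A B ≤ 2 ^ K → m < A.ncard → K < s A → r A = r B := by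
    intro A B K hA hB hA' hB' h hmA hK
    obtain ⟨hk, hmin⟩ := hs A hA hmA
    obtain ⟨heq, hmB, hkB, hminB⟩ := hp.least_scale_transfer hA hB hA' hB' h hK hk hmin
    obtain ⟨hk', hmin'⟩ := hs B hB hmB
    rw [r_large A hmA, r_large B hmB, heq, le_antisymm (hminB _ hk') (hmin' _ hkB)]
  have r_near : ∀ (A : Set X) (K : ℤ), (m < A.ncard → s A ≤ K) →
      hausdorffDist A (r A) ≤ 2 ^ K / c := by
    intro A K h
    rcases le_or_gt A.ncard m with hmA | hmA
    · rw [r_small A hmA, hausdorffDist_self_zero]; positivity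
    · rw [r_large A hmA]
      refine (hp.hausdorffDist_image_le hc A _).trans ?_
      gcongr
      · exact one_le_two
      · exact h hmA
  refine ⟨r, fun A hA => r_mem A hA.1 hA.2.1, fun A hA => r_small A hA.2.2.1, ?_⟩
  rintro A B ⟨hA, hA', -, -⟩ ⟨hB, hB', -, -⟩
  have hL : 0 ≤ (1 + 4 / c) * hausdorffDist A B :=
    mul_nonneg (by positivity) hausdorffDist_nonneg
  have ne_top : ∀ {S T : Set X}, S.Finite → T.Finite → S.Nonempty → T.Nonempty →
      hausdorffEDist S T ≠ ⊤ := fun hS hT hS' hT' =>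
    hausdorffEDist_ne_top_of_nonempty_of_bounded hS' hT' hS.isBounded hT.isBounded
  rcases hausdorffDist_nonneg.eq_or_lt' (a := hausdorffDist A B) with h0 | hpos
  · obtain rfl : A = B :=
      (hA.isClosed.hausdorffDist_zero_iff_eq hB.isClosed (ne_top hA hB hA' hB')).1 h0
    rwa [hausdorffDist_self_zero]
  obtain ⟨i, hi, hiδ⟩ := exists_mem_Ioc_zpow hpos (one_lt_two (α := ℝ))
  by_cases hAK : m < A.ncard ∧ i + 1 < s A
  · rwa [r_eq A B _ hA hB hA' hB' hiδ hAK.1 hAK.2, hausdorffDist_self_zero]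
  by_cases hBK : m < B.ncard ∧ i + 1 < s B
  · rwa [r_eq B A _ hB hA hB' hA' (by rwa [hausdorffDist_comm]) hBK.1 hBK.2,
      hausdorffDist_self_zero]
  have h₁ := r_near A (i + 1) fun h => not_lt.1 fun h' => hAK ⟨h, h'⟩
  have h₂ := r_near B (i + 1) fun h => not_lt.1 fun h' => hBK ⟨h, h'⟩
  obtain ⟨hrA, hrA', -⟩ := r_mem A hA hA'
  obtain ⟨hrB, hrB', -⟩ := r_mem B hB hB'
  have h₃ : (2 : ℝ) ^ (i + 1) / c ≤ 2 * hausdorffDist A B / c := by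
    rw [zpow_add_one₀ two_ne_zero, mul_comm]
    gcongr
  have h₄ := hausdorffDist_triangle (u := r B) (ne_top hrA hA hrA' hA')
  have h₅ := hausdorffDist_triangle (u := r B) (ne_top hA hB hA' hB')
  rw [hausdorffDist_comm (s := r A) (t := A)] at h₄
  have h₆ : (1 + 4 / c) * hausdorffDist A B =
      2 * hausdorffDist A B / c + hausdorffDist A B + 2 * hausdorffDist A B / c := by ring
  linarith

end IsCentreSystem

/-- Theorem (Corollary 3.3): a uniformly disconnected metric space admits, for a single
constant `L ≥ 1`, `L`-Lipschitz retractions `X(n) → X(m)` for all `n > m ≥ 1`. -/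
theorem uniformly_disconnected_uniform_lipschitz_retractions {X : Type*} [MetricSpace X]
    (hud : UniformlyDisconnected X) :
    ∃ L : ℝ, 1 ≤ L ∧ ∀ n m : ℕ, 1 ≤ m → m < n →
      ∃ r : Set X → Set X, IsLipschitzRetraction (Set.univ : Set X) n m L r := by
  obtain ⟨c, hc, h⟩ := hud
  obtain ⟨p, hp⟩ := exists_isCentreSystem h
  exact ⟨1 + 4 / c, le_add_of_nonneg_right (by positivity), fun n m hm _ =>
    hp.exists_isLipschitzRetraction hc hm⟩
end

section
/- Let A, B be nonempty subsets of ℝ with at most n elements such that max(δ_n(A), δ_n(B)) > 2·Δ(A,B), where Δ is the Hausdorff distance. Then there exists a strictly increasing bijection φ : A → B such that |a − φ(a)| ≤ Δ(A,B) for all a ∈ A; moreover, Δ(A \ {min A}, B \ {min B}) ≤ Δ(A,B). -/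
/-- The minimum separation function `δ_n` on finite subsets of `ℝ`:
`δ_n(A) = 0` if `|A| < n` (or `|A| > n`), and `δ_n(A)` is the minimal distance between
two distinct points of `A` if `|A| = n`. -/
noncomputable def minSep (n : ℕ) (A : Finset ℝ) : ℝ :=
  if A.card = n then sInf {d : ℝ | ∃ a ∈ A, ∃ b ∈ A, a ≠ b ∧ d = dist a b} else 0

/-- A point of a finite set `A` has a point of `B` within the Hausdorff distance of `A` and `B`. -/
theorem Finset.exists_dist_le_hausdorffDist {A B : Finset ℝ} (hB : B.Nonempty) {a : ℝ}
    (ha : a ∈ A) : ∃ b ∈ B, |a - b| ≤ Metric.hausdorffDist (A : Set ℝ) (B : Set ℝ) := by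
  have hfin : Metric.hausdorffEDist (A : Set ℝ) (B : Set ℝ) ≠ ⊤ :=
    Metric.hausdorffEDist_ne_top_of_nonempty_of_bounded ⟨a, ha⟩ hB
      A.finite_toSet.isBounded B.finite_toSet.isBounded
  obtain ⟨b, hb, hab⟩ := B.finite_toSet.isCompact.exists_infDist_eq_dist hB a
  refine ⟨b, hb, ?_⟩
  rw [← Real.dist_eq, ← hab]
  exact Metric.infDist_le_hausdorffDist_of_mem ha hfin

theorem minSep_le_abs_sub {n : ℕ} {A : Finset ℝ} (hn : A.card = n) {a b : ℝ} (ha : a ∈ A)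
    (hb : b ∈ A) (hab : a ≠ b) : minSep n A ≤ |a - b| := by
  rw [minSep, if_pos hn, ← Real.dist_eq]
  refine csInf_le ⟨0, ?_⟩ ⟨a, ha, b, hb, hab, rfl⟩
  rintro _ ⟨x, -, y, -, -, rfl⟩
  exact dist_nonneg

/-- If `B` is `2r`-separated, has at least as many points as `A`, and lies at Hausdorff distance
at most `r` from `A`, then there is an increasing bijection `A → B` moving points by at most `r`. -/
theorem exists_bijOn_strictMonoOn_of_separated {A B : Finset ℝ} {r : ℝ}
    (hcard : A.card ≤ B.card) (hsep : ∀ x ∈ B, ∀ y ∈ B, x ≠ y → 2 * r < |x - y|)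
    (hAB : ∀ a ∈ A, ∃ b ∈ B, |a - b| ≤ r) (hBA : ∀ b ∈ B, ∃ a ∈ A, |b - a| ≤ r) :
    ∃ φ : ℝ → ℝ, Set.BijOn φ (A : Set ℝ) (B : Set ℝ) ∧ StrictMonoOn φ (A : Set ℝ) ∧
      ∀ a ∈ A, |a - φ a| ≤ r := by
  choose! φ hφB hφ using hAB
  have hsurj : Set.SurjOn φ (A : Set ℝ) (B : Set ℝ) := by
    intro b hb
    obtain ⟨a, ha, hab⟩ := hBA b hb
    refine ⟨a, ha, ?_⟩
    by_contra hne
    have h1 := hsep _ (hφB a ha) b hb hne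
    have h2 := abs_sub_le (φ a) a b
    have h3 := hφ a ha
    rw [abs_sub_comm] at h3 hab
    linarith
  have hinj : Set.InjOn φ (A : Set ℝ) := Finset.injOn_of_surjOn_of_card_le φ hφB hsurj hcard
  refine ⟨φ, ⟨hφB, hinj, hsurj⟩, fun a ha a' ha' haa' => ?_, hφ⟩
  by_contra! hle
  have h1 := hsep _ (hφB a ha) _ (hφB a' ha') fun h => haa'.ne (hinj ha ha' h)
  rw [abs_of_nonneg (sub_nonneg.2 hle)] at h1
  have h2 := abs_le.1 (hφ a ha)
  have h3 := abs_le.1 (hφ a' ha')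
  linarith

/-- An increasing bijection between finite sets of reals induces one after removing the minima, so
the Hausdorff distance of the remainders is at most the displacement. -/
theorem hausdorffDist_erase_min'_le {A B : Finset ℝ} (hA : A.Nonempty) (hB : B.Nonempty) {r : ℝ}
    (hr : 0 ≤ r) {φ : ℝ → ℝ} (hbij : Set.BijOn φ (A : Set ℝ) (B : Set ℝ))
    (hmono : StrictMonoOn φ (A : Set ℝ)) (hφ : ∀ a ∈ A, |a - φ a| ≤ r) :
    Metric.hausdorffDist ((A.erase (A.min' hA) : Finset ℝ) : Set ℝ)
      ((B.erase (B.min' hB) : Finset ℝ) : Set ℝ) ≤ r := by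
  have hmin : φ (A.min' hA) = B.min' hB := by
    refine le_antisymm ?_ (B.min'_le _ (hbij.mapsTo (A.min'_mem hA)))
    obtain ⟨a, ha, hab⟩ := hbij.surjOn (B.min'_mem hB)
    rw [← hab]
    exact hmono.monotoneOn (A.min'_mem hA) ha (A.min'_le a ha)
  refine Metric.hausdorffDist_le_of_mem_dist hr (fun a ha => ?_) fun b hb => ?_
  · obtain ⟨hne, ha⟩ := Finset.mem_erase.1 ha
    refine ⟨φ a, Finset.mem_erase.2 ⟨fun h => hne ?_, hbij.mapsTo ha⟩, hφ a ha⟩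
    exact hbij.injOn ha (A.min'_mem hA) (h.trans hmin.symm)
  · obtain ⟨hne, hb⟩ := Finset.mem_erase.1 hb
    obtain ⟨a, ha, rfl⟩ := hbij.surjOn hb
    refine ⟨a, Finset.mem_erase.2 ⟨fun h => hne ?_, ha⟩, ?_⟩
    · rw [h, hmin]
    · rw [dist_comm]
      exact hφ a ha


/-- Lemma 4.1: if `A, B ∈ ℝ(n)` satisfy `max(δ_n(A), δ_n(B)) > 2 Δ(A,B)`, then there is
an order-preserving bijection `φ : A → B` moving each point by at most `Δ(A,B)`, and
removing the minima does not increase the Hausdorff distance. -/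
theorem exists_orderPreserving_bijection (n : ℕ) (A B : Finset ℝ)
    (hA : A.Nonempty) (hB : B.Nonempty) (hAn : A.card ≤ n) (hBn : B.card ≤ n)
    (hsep : 2 * Metric.hausdorffDist (A : Set ℝ) (B : Set ℝ) <
      max (minSep n A) (minSep n B)) :
    (∃ φ : ℝ → ℝ, Set.BijOn φ (A : Set ℝ) (B : Set ℝ) ∧ StrictMonoOn φ (A : Set ℝ) ∧
      ∀ a ∈ A, |a - φ a| ≤ Metric.hausdorffDist (A : Set ℝ) (B : Set ℝ)) ∧
    Metric.hausdorffDist ((A.erase (A.min' hA) : Finset ℝ) : Set ℝ)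
        ((B.erase (B.min' hB) : Finset ℝ) : Set ℝ) ≤
      Metric.hausdorffDist (A : Set ℝ) (B : Set ℝ) := by
  set r := Metric.hausdorffDist (A : Set ℝ) (B : Set ℝ) with hr
  have hr0 : 0 ≤ r := Metric.hausdorffDist_nonneg
  have hAB : ∀ a ∈ A, ∃ b ∈ B, |a - b| ≤ r := fun a ha =>
    Finset.exists_dist_le_hausdorffDist hB ha
  have hBA : ∀ b ∈ B, ∃ a ∈ A, |b - a| ≤ r := fun b hb => by
    rw [hr, Metric.hausdorffDist_comm]
    exact Finset.exists_dist_le_hausdorffDist hA hb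
  have card_eq : ∀ C : Finset ℝ, 2 * r < minSep n C → C.card = n := fun C h => by
    by_contra hne
    rw [minSep, if_neg hne] at h
    linarith
  suffices h : ∃ φ : ℝ → ℝ, Set.BijOn φ (A : Set ℝ) (B : Set ℝ) ∧ StrictMonoOn φ (A : Set ℝ) ∧
      ∀ a ∈ A, |a - φ a| ≤ r by
    obtain ⟨φ, hbij, hmono, hφ⟩ := h
    exact ⟨⟨φ, hbij, hmono, hφ⟩, hausdorffDist_erase_min'_le hA hB hr0 hbij hmono hφ⟩
  rcases lt_max_iff.1 hsep with h | h
  · have hn := card_eq A h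
    obtain ⟨ψ, hbij, hmono, hψ⟩ := exists_bijOn_strictMonoOn_of_separated (hn.symm ▸ hBn)
      (fun x hx y hy hxy => h.trans_le (minSep_le_abs_sub hn hx hy hxy)) hBA hAB
    have hinv := hbij.invOn_invFunOn
    have hbij' : Set.BijOn (Function.invFunOn ψ B) (A : Set ℝ) (B : Set ℝ) :=
      hbij.symm hinv.symm
    refine ⟨Function.invFunOn ψ B, hbij', fun a ha a' ha' haa' => ?_, fun a ha => ?_⟩
    · rw [← hmono.lt_iff_lt (hbij'.mapsTo ha) (hbij'.mapsTo ha'), hinv.2 ha, hinv.2 ha']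
      exact haa'
    · have := hψ _ (hbij'.mapsTo ha)
      rwa [hinv.2 ha, abs_sub_comm] at this
  · have hn := card_eq B h
    exact exists_bijOn_strictMonoOn_of_separated (hn.symm ▸ hAn)
      (fun x hx y hy hxy => h.trans_le (minSep_le_abs_sub hn hx hy hxy)) hAB hBA
end

section
/- Suppose X ⊂ ℝ is a union of finitely many pairwise disjoint nonempty compact intervals I_1, …, I_m (some of which may be single points), with the restriction metric. Then X has the Lipschitz Clustering Property: for every n ≥ 2 there exists a Lipschitz retraction from X(n) onto X(n−1). -/
namespace LipschitzClustering

open Set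

variable {ι : Type*}

/-- Each point of either set is within `h` of the other set. -/
def Near (A B : Set ℝ) (h : ℝ) : Prop :=
  (∀ x ∈ A, ∃ y ∈ B, |x - y| ≤ h) ∧ (∀ y ∈ B, ∃ x ∈ A, |y - x| ≤ h)

lemma Near.symm {A B : Set ℝ} {h : ℝ} (H : Near A B h) : Near B A h := ⟨H.2, H.1⟩

lemma Near.trans {A B C : Set ℝ} {h k : ℝ} (H : Near A B h) (K : Near B C k) :
    Near A C (h + k) := by
  constructor
  · intro x hx
    obtain ⟨y, hy, hxy⟩ := H.1 x hx
    obtain ⟨z, hz, hyz⟩ := K.1 y hy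
    exact ⟨z, hz, (abs_sub_le x y z).trans (add_le_add hxy hyz)⟩
  · intro z hz
    obtain ⟨y, hy, hyz⟩ := K.2 z hz
    obtain ⟨x, hx, hxy⟩ := H.2 y hy
    exact ⟨x, hx, (abs_sub_le z y x).trans (by linarith)⟩

lemma Near.mono {A B : Set ℝ} {h k : ℝ} (H : Near A B h) (hk : h ≤ k) : Near A B k := by
  constructor
  · intro x hx
    obtain ⟨y, hy, hxy⟩ := H.1 x hx
    exact ⟨y, hy, hxy.trans hk⟩
  · intro x hx
    obtain ⟨y, hy, hxy⟩ := H.2 x hx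
    exact ⟨y, hy, hxy.trans hk⟩

lemma near_image {A : Set ℝ} {f g : ℝ → ℝ} {h : ℝ} (H : ∀ x ∈ A, |f x - g x| ≤ h) :
    Near (f '' A) (g '' A) h := by
  constructor
  · rintro _ ⟨x, hx, rfl⟩
    exact ⟨g x, ⟨x, hx, rfl⟩, H x hx⟩
  · rintro _ ⟨x, hx, rfl⟩
    exact ⟨f x, ⟨x, hx, rfl⟩, abs_sub_comm (f x) (g x) ▸ H x hx⟩

lemma near_hausdorffDist {A B : Set ℝ} (hA : A.Finite) (hB : B.Finite) (hA' : A.Nonempty)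
    (hB' : B.Nonempty) : Near A B (Metric.hausdorffDist A B) := by
  have key : ∀ {A B : Set ℝ}, A.Finite → B.Finite → A.Nonempty → B.Nonempty →
      ∀ x ∈ A, ∃ y ∈ B, |x - y| ≤ Metric.hausdorffDist A B := by
    intro A B hA hB hA' hB' x hx
    obtain ⟨y, hy, hxy⟩ := hB.isCompact.exists_infDist_eq_dist hB' x
    refine ⟨y, hy, ?_⟩
    rw [← Real.dist_eq, ← hxy]
    exact Metric.infDist_le_hausdorffDist_of_mem hx
      (Metric.hausdorffEDist_ne_top_of_nonempty_of_bounded hA' hB' hA.isBounded hB.isBounded)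
  refine ⟨key hA hB hA' hB', ?_⟩
  rw [Metric.hausdorffDist_comm]
  exact key hB hA hB' hA'

lemma Near.hausdorffDist_le {A B : Set ℝ} {h : ℝ} (H : Near A B h) (hh : 0 ≤ h) :
    Metric.hausdorffDist A B ≤ h := by
  refine Metric.hausdorffDist_le_of_mem_dist hh ?_ ?_
  · simpa only [Real.dist_eq] using H.1
  · simpa only [Real.dist_eq] using H.2

/-- The number of points of `A` below `x` with the same label as `x`. -/
noncomputable def rank (c : ℝ → ι) (A : Set ℝ) (x : ℝ) : ℕ :=
  {y | y ∈ A ∧ c y = c x ∧ y < x}.ncard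

/-- The gaps between points of `A` carrying the same label. -/
def gaps (c : ℝ → ι) (A : Set ℝ) : Set ℝ :=
  {t | ∃ x ∈ A, ∃ y ∈ A, c x = c y ∧ x < y ∧ t = y - x}

open Classical in
/-- The smallest gap between equally labelled points of an `n`-point set `A`; it is `0` when there
is no such gap or `A` does not have `n` points. -/
noncomputable def minGap (c : ℝ → ι) (n : ℕ) (A : Set ℝ) : ℝ :=
  if A.ncard = n then sInf (gaps c A) else 0

/-- Move each point of `A` down by its rank times the minimal gap. -/
noncomputable def shift (c : ℝ → ι) (n : ℕ) (A : Set ℝ) : Set ℝ :=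
  (fun x => x - rank c A x * minGap c n A) '' A

open Classical in
/-- The retraction: `shift`, except that `n`-point sets with distinct labels go to `{x₀}`. -/
noncomputable def collapse (c : ℝ → ι) (n : ℕ) (x₀ : ℝ) (A : Set ℝ) : Set ℝ :=
  if A.ncard = n ∧ InjOn c A then {x₀} else shift c n A

variable {c : ℝ → ι} {n : ℕ} {A B X : Set ℝ} {h d : ℝ}

lemma gaps_finite (hA : A.Finite) : (gaps c A).Finite := by
  refine ((hA.prod hA).image fun p => p.2 - p.1).subset ?_
  rintro t ⟨x, hx, y, hy, -, -, rfl⟩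
  exact ⟨(x, y), ⟨hx, hy⟩, rfl⟩

lemma gaps_pos {t : ℝ} (ht : t ∈ gaps c A) : 0 < t := by
  obtain ⟨x, -, y, -, -, hxy, rfl⟩ := ht
  linarith

lemma gaps_nonempty (hc : ¬ InjOn c A) : (gaps c A).Nonempty := by
  simp only [InjOn, not_forall] at hc
  obtain ⟨x, hx, y, hy, hxy, hne⟩ := hc
  rcases lt_or_gt_of_ne hne with hlt | hlt
  · exact ⟨_, x, hx, y, hy, hxy, hlt, rfl⟩
  · exact ⟨_, y, hy, x, hx, hxy.symm, hlt, rfl⟩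

lemma minGap_nonneg : 0 ≤ minGap c n A := by
  unfold minGap
  split_ifs
  · exact Real.sInf_nonneg fun t ht => (gaps_pos ht).le
  · exact le_rfl

lemma minGap_eq_zero (hA : A.ncard ≠ n) : minGap c n A = 0 := if_neg hA

lemma minGap_le (hA : A.Finite) {x y : ℝ} (hx : x ∈ A) (hy : y ∈ A) (hc : c x = c y)
    (hxy : x < y) : minGap c n A ≤ y - x := by
  unfold minGap
  split_ifs
  · exact csInf_le (gaps_finite hA).bddBelow ⟨x, hx, y, hy, hc, hxy, rfl⟩
  · linarith

lemma exists_minGap (hA : A.Finite) (hn : A.ncard = n) (hc : ¬ InjOn c A) :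
    ∃ x ∈ A, ∃ y ∈ A, c x = c y ∧ x < y ∧ minGap c n A = y - x := by
  rw [minGap, if_pos hn]
  exact (gaps_nonempty hc).csInf_mem (gaps_finite hA)

lemma ncard_eq_of_minGap_pos (hp : 0 < minGap c n A) : A.ncard = n := by
  by_contra hne
  exact hp.ne' (minGap_eq_zero hne)

lemma not_injOn_of_minGap_pos (hp : 0 < minGap c n A) : ¬ InjOn c A := by
  intro hc
  have hemp : gaps c A = ∅ := by
    refine eq_empty_of_forall_notMem ?_
    rintro t ⟨x, hx, y, hy, hxy, hlt, -⟩
    exact hlt.ne (hc hx hy hxy)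
  rw [minGap, if_pos (ncard_eq_of_minGap_pos hp), hemp, Real.sInf_empty] at hp
  exact lt_irrefl _ hp

lemma rank_le (hA : A.Finite) (x : ℝ) : rank c A x ≤ A.ncard :=
  ncard_le_ncard (fun _ hy => hy.1) hA

lemma add_card_mul_le {a δ : ℝ} (T : Finset ℝ) :
    ∀ x, a ≤ x → (∀ y ∈ T, a ≤ y) → (∀ y ∈ T, ∀ z ∈ T, y < z → y + δ ≤ z) →
      (∀ y ∈ T, y + δ ≤ x) → a + T.card * δ ≤ x := by
  induction T using Finset.induction_on_max with
  | empty => intro x hx _ _ _; simpa using hx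
  | insert M T hM ih =>
    intro x _ ha hg hx
    have hMT : M ∉ T := fun hmem => lt_irrefl _ (hM M hmem)
    have h₁ := ih M (ha M (Finset.mem_insert_self _ _))
      (fun y hy => ha y (Finset.mem_insert_of_mem hy))
      (fun y hy z hz => hg y (Finset.mem_insert_of_mem hy) z (Finset.mem_insert_of_mem hz))
      (fun y hy => hg y (Finset.mem_insert_of_mem hy) M (Finset.mem_insert_self _ _) (hM y hy))
    have h₂ := hx M (Finset.mem_insert_self _ _)
    rw [Finset.card_insert_of_notMem hMT]
    push_cast
    linarith

lemma exists_le_shift (hA : A.Finite) {x : ℝ} (hx : x ∈ A) :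
    ∃ y ∈ A, c y = c x ∧ y ≤ x - rank c A x * minGap c n A := by
  have hfin : {y | y ∈ A ∧ c y = c x ∧ y < x}.Finite := hA.subset fun y hy => hy.1
  obtain ⟨y, ⟨hy, hyc, hyx⟩, hmin⟩ := (hA.subset (fun y hy => hy.1 :
    {y | y ∈ A ∧ c y = c x ∧ y ≤ x} ⊆ A)).exists_minimalFor id _ ⟨x, hx, rfl, le_rfl⟩
  refine ⟨y, hy, hyc, ?_⟩
  have key := add_card_mul_le (a := y) (δ := minGap c n A) hfin.toFinset x hyx ?_ ?_ ?_
  · rw [← ncard_eq_toFinset_card _ hfin] at key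
    unfold rank
    linarith
  · intro z hz
    simp only [Finite.mem_toFinset, mem_ofPred_eq] at hz
    by_contra! hlt
    exact absurd (hmin ⟨hz.1, hz.2.1, hz.2.2.le⟩ hlt.le) (not_le.2 hlt)
  · intro z hz w hw hzw
    simp only [Finite.mem_toFinset, mem_ofPred_eq] at hz hw
    linarith [minGap_le (n := n) hA hz.1 hw.1 (hz.2.1.trans hw.2.1.symm) hzw]
  · intro z hz
    simp only [Finite.mem_toFinset, mem_ofPred_eq] at hz
    linarith [minGap_le (n := n) hA hz.1 hx hz.2.1 hz.2.2]

lemma shift_subset (hA : A.Finite) (hAX : A ⊆ X)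
    (hX : ∀ x ∈ X, ∀ y ∈ X, c x = c y → Icc x y ⊆ X) : shift c n A ⊆ X := by
  rintro _ ⟨x, hx, rfl⟩
  obtain ⟨y, hy, hyc, hle⟩ := exists_le_shift (n := n) hA (c := c) hx
  refine hX y (hAX hy) x (hAX hx) hyc ⟨hle, ?_⟩
  have := mul_nonneg (rank c A x).cast_nonneg (minGap_nonneg (c := c) (n := n) (A := A))
  simpa using this

lemma shift_eq_self (hn : A.ncard ≠ n) : shift c n A = A := by
  simp [shift, minGap_eq_zero hn]

lemma ncard_shift_lt (hA : A.Finite) (hn : A.ncard = n) (hc : ¬ InjOn c A) :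
    (shift c n A).ncard < n := by
  obtain ⟨x, hx, y, hy, hxy, hlt, hδ⟩ := exists_minGap hA hn hc
  have hrank : rank c A y = rank c A x + 1 := by
    have hset : {z | z ∈ A ∧ c z = c y ∧ z < y} = insert x {z | z ∈ A ∧ c z = c x ∧ z < x} := by
      ext z
      simp only [mem_ofPred_eq, mem_insert_iff]
      constructor
      · rintro ⟨hz, hzc, hzy⟩
        rcases lt_trichotomy z x with hzx | hzx | hzx
        · exact Or.inr ⟨hz, hzc.trans hxy.symm, hzx⟩
        · exact Or.inl hzx
        · have := minGap_le (n := n) hA hx hz (hxy.trans hzc.symm) hzx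
          linarith
      · rintro (rfl | ⟨hz, hzc, hzx⟩)
        · exact ⟨hx, hxy, hlt⟩
        · exact ⟨hz, hzc.trans hxy, hzx.trans hlt⟩
    rw [rank, rank, hset, ncard_insert_of_notMem (fun hmem => lt_irrefl _ hmem.2.2)
      (hA.subset fun z hz => hz.1)]
  have hle : (shift c n A).ncard ≤ A.ncard := ncard_image_le hA
  refine lt_of_le_of_ne (hn ▸ hle) fun heq => hlt.ne ?_
  refine injOn_of_ncard_image_eq (heq.trans hn.symm) hA hx hy ?_
  simp only [hrank, hδ]
  push_cast
  ring

lemma near_shift_self (hA : A.Finite) (hn : A.ncard ≤ n) :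
    Near (shift c n A) A (n * minGap c n A) := by
  have := near_image (A := A) (f := fun x => x - rank c A x * minGap c n A) (g := id)
    (h := n * minGap c n A) ?_
  · simpa [shift] using this
  · intro x _
    have hr : (rank c A x : ℝ) ≤ n := by exact_mod_cast (rank_le hA x).trans hn
    have h₀ := minGap_nonneg (c := c) (n := n) (A := A)
    have : x - rank c A x * minGap c n A - id x = -(rank c A x * minGap c n A) := by
      simp
    rw [this, abs_neg, abs_of_nonneg (by positivity)]
    exact mul_le_mul_of_nonneg_right hr h₀

lemma near_shift_of_lt (hA : A.Finite) (hB : B.Finite) (hBn : B.ncard ≤ n)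
    (hlab : ∀ x ∈ A, ∀ y ∈ B, |x - y| ≤ h → c x = c y) (h₀ : 0 ≤ h) (hAB : Near A B h)
    (hgap : 2 * h < minGap c n A) : Near (shift c n A) (shift c n B) ((1 + 2 * n) * h) := by
  have hpos : 0 < minGap c n A := by linarith
  have hAn := ncard_eq_of_minGap_pos hpos
  have hAc := not_injOn_of_minGap_pos hpos
  choose! f hfB hf using hAB.1
  have hfc : ∀ x ∈ A, c (f x) = c x := fun x hx => (hlab x hx _ (hfB x hx) (hf x hx)).symm
  have hmono : ∀ x ∈ A, ∀ y ∈ A, c x = c y → x < y → f x < f y := by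
    intro x hx y hy hxy hlt
    have := minGap_le (n := n) hA hx hy hxy hlt
    have h₁ := abs_le.1 (hf x hx)
    have h₂ := abs_le.1 (hf y hy)
    linarith
  have hmono' : ∀ x ∈ A, ∀ y ∈ A, c x = c y → f x < f y → x < y := by
    intro x hx y hy hxy hlt
    by_contra! hle
    rcases hle.eq_or_lt with rfl | hlt'
    · exact lt_irrefl _ hlt
    · exact lt_asymm hlt (hmono y hy x hx hxy.symm hlt')
  have hinj : InjOn f A := by
    intro x hx y hy hxy
    have hcxy : c x = c y := by rw [← hfc x hx, ← hfc y hy, hxy]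
    rcases lt_trichotomy x y with hlt | heq | hlt
    · exact absurd hxy (hmono x hx y hy hcxy hlt).ne
    · exact heq
    · exact absurd hxy (hmono y hy x hx hcxy.symm hlt).ne'
  have himg : f '' A = B := by
    refine eq_of_subset_of_ncard_le (image_subset_iff.2 hfB) ?_ hB
    rw [hinj.ncard_image, hAn]
    exact hBn
  have hBn' : B.ncard = n := by rw [← himg, hinj.ncard_image, hAn]
  have hrank : ∀ x ∈ A, rank c B (f x) = rank c A x := by
    intro x hx
    have hset : {y | y ∈ B ∧ c y = c (f x) ∧ y < f x} =
        f '' {y | y ∈ A ∧ c y = c x ∧ y < x} := by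
      ext z
      constructor
      · rintro ⟨hz, hzc, hzx⟩
        rw [← himg] at hz
        obtain ⟨y, hy, rfl⟩ := hz
        rw [hfc y hy, hfc x hx] at hzc
        exact ⟨y, ⟨hy, hzc, hmono' y hy x hx hzc hzx⟩, rfl⟩
      · rintro ⟨y, ⟨hy, hyc, hyx⟩, rfl⟩
        exact ⟨hfB y hy, by rw [hfc y hy, hfc x hx, hyc], hmono y hy x hx hyc hyx⟩
    rw [rank, rank, hset, (hinj.mono fun y hy => hy.1).ncard_image]
  obtain ⟨x, hx, y, hy, hxy, hlt, hδ⟩ := exists_minGap hA hAn hAc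
  have hcf : c (f x) = c (f y) := by rw [hfc x hx, hfc y hy, hxy]
  have hle₁ : minGap c n B ≤ minGap c n A + 2 * h := by
    have := minGap_le (n := n) hB (hfB x hx) (hfB y hy) hcf (hmono x hx y hy hxy hlt)
    have h₁ := abs_le.1 (hf x hx)
    have h₂ := abs_le.1 (hf y hy)
    linarith
  have hBc : ¬ InjOn c B := fun hc =>
    (hmono x hx y hy hxy hlt).ne (hc (hfB x hx) (hfB y hy) hcf)
  have hle₂ : minGap c n A ≤ minGap c n B + 2 * h := by
    obtain ⟨u, hu, v, hv, huv, hlt', hδ'⟩ := exists_minGap hB hBn' hBc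
    rw [← himg] at hu hv
    obtain ⟨u, hu, rfl⟩ := hu
    obtain ⟨v, hv, rfl⟩ := hv
    rw [hfc u hu, hfc v hv] at huv
    have := minGap_le (n := n) hA hu hv huv (hmono' u hu v hv huv hlt')
    have h₁ := abs_le.1 (hf u hu)
    have h₂ := abs_le.1 (hf v hv)
    linarith
  have hsB : shift c n B = (fun x => f x - rank c A x * minGap c n B) '' A := by
    rw [shift, ← image_congr (fun x hx => by rw [hrank x hx] :
      ∀ x ∈ A, f x - rank c B (f x) * minGap c n B = f x - rank c A x * minGap c n B)]
    conv_lhs => rw [← himg]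
    rw [image_image, himg]
  rw [hsB]
  refine near_image fun x hx => ?_
  have hr : (rank c A x : ℝ) ≤ n := by exact_mod_cast hAn ▸ rank_le hA x
  have hdiff : |minGap c n B - minGap c n A| ≤ 2 * h := abs_le.2 ⟨by linarith, by linarith⟩
  calc |x - rank c A x * minGap c n A - (f x - rank c A x * minGap c n B)|
      = |(x - f x) + rank c A x * (minGap c n B - minGap c n A)| := by congr 1; ring
    _ ≤ |x - f x| + |rank c A x * (minGap c n B - minGap c n A)| := abs_add_le _ _
    _ = |x - f x| + rank c A x * |minGap c n B - minGap c n A| := by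
        rw [abs_mul, Nat.abs_cast]
    _ ≤ h + n * (2 * h) := add_le_add (hf x hx)
        (mul_le_mul hr hdiff (abs_nonneg _) (Nat.cast_nonneg _))
    _ = (1 + 2 * n) * h := by ring

lemma near_shift (hA : A.Finite) (hB : B.Finite) (hAn : A.ncard ≤ n) (hBn : B.ncard ≤ n)
    (hlab : ∀ x ∈ A, ∀ y ∈ B, |x - y| ≤ h → c x = c y) (h₀ : 0 ≤ h) (hAB : Near A B h) :
    Near (shift c n A) (shift c n B) ((1 + 4 * n) * h) := by
  have hle : (1 + 2 * n) * h ≤ (1 + 4 * n) * h := by gcongr; norm_num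
  rcases lt_or_ge (2 * h) (minGap c n A) with hgA | hgA
  · exact (near_shift_of_lt hA hB hBn hlab h₀ hAB hgA).mono hle
  rcases lt_or_ge (2 * h) (minGap c n B) with hgB | hgB
  · exact (near_shift_of_lt hB hA hAn
      (fun x hx y hy hxy => (hlab y hy x hx (abs_sub_comm x y ▸ hxy)).symm) h₀ hAB.symm
      hgB).symm.mono hle
  · refine (((near_shift_self hA hAn).trans hAB).trans (near_shift_self hB hBn).symm).mono ?_
    have h₁ := mul_le_mul_of_nonneg_left hgA (Nat.cast_nonneg (α := ℝ) n)
    have h₂ := mul_le_mul_of_nonneg_left hgB (Nat.cast_nonneg (α := ℝ) n)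
    linarith

lemma injOn_label_of_near (hB : B.Finite) (hBn : B.ncard ≤ n)
    (hlab : ∀ x ∈ A, ∀ y ∈ B, |x - y| ≤ h → c x = c y) (hAB : Near A B h)
    (hA : A.ncard = n ∧ InjOn c A) : B.ncard = n ∧ InjOn c B := by
  choose! f hfB hf using hAB.1
  have hfc : ∀ x ∈ A, c (f x) = c x := fun x hx => (hlab x hx _ (hfB x hx) (hf x hx)).symm
  have hinj : InjOn f A := fun x hx y hy hxy =>
    hA.2 hx hy (by rw [← hfc x hx, ← hfc y hy, hxy])
  have himg : f '' A = B := by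
    refine eq_of_subset_of_ncard_le (image_subset_iff.2 hfB) ?_ hB
    rw [hinj.ncard_image, hA.1]
    exact hBn
  refine ⟨by rw [← himg, hinj.ncard_image, hA.1], ?_⟩
  rw [← himg]
  rintro _ ⟨x, hx, rfl⟩ _ ⟨y, hy, rfl⟩ hxy
  rw [hfc x hx, hfc y hy] at hxy
  rw [hA.2 hx hy hxy]

lemma memFinSubsetSpace_collapse {x₀ : ℝ} (hx₀ : x₀ ∈ X) (hn : 2 ≤ n)
    (hX : ∀ x ∈ X, ∀ y ∈ X, c x = c y → Icc x y ⊆ X) (hA : MemFinSubsetSpace X n A) :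
    MemFinSubsetSpace X (n - 1) (collapse c n x₀ A) := by
  obtain ⟨hfin, hne, hcard, hsub⟩ := hA
  unfold collapse
  split_ifs with hs
  · refine ⟨finite_singleton _, singleton_nonempty _, ?_, singleton_subset_iff.2 hx₀⟩
    rw [ncard_singleton]
    omega
  · refine ⟨hfin.image _, hne.image _, ?_, shift_subset hfin hsub hX⟩
    by_cases hcn : A.ncard = n
    · have := ncard_shift_lt hfin hcn fun hc => hs ⟨hcn, hc⟩
      omega
    · rw [shift_eq_self hcn]
      omega

lemma collapse_eq_self {x₀ : ℝ} (hn : 2 ≤ n) (hA : MemFinSubsetSpace X (n - 1) A) :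
    collapse c n x₀ A = A := by
  have hne : A.ncard ≠ n := by have := hA.2.2.1; omega
  rw [collapse, if_neg fun hs => hne hs.1, shift_eq_self hne]

lemma near_collapse {x₀ : ℝ} (hA : A.Finite) (hB : B.Finite) (hAn : A.ncard ≤ n)
    (hBn : B.ncard ≤ n) (hlab : ∀ x ∈ A, ∀ y ∈ B, |x - y| ≤ h → c x = c y) (h₀ : 0 ≤ h)
    (hAB : Near A B h) :
    Near (collapse c n x₀ A) (collapse c n x₀ B) ((1 + 4 * n) * h) := by
  have hiff : (A.ncard = n ∧ InjOn c A) ↔ (B.ncard = n ∧ InjOn c B) :=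
    ⟨injOn_label_of_near hB hBn hlab hAB, injOn_label_of_near hA hAn
      (fun x hx y hy hxy => (hlab y hy x hx (abs_sub_comm x y ▸ hxy)).symm) hAB.symm⟩
  unfold collapse
  by_cases hs : A.ncard = n ∧ InjOn c A
  · rw [if_pos hs, if_pos (hiff.1 hs)]
    have hL : 0 ≤ (1 + 4 * (n : ℝ)) * h := by positivity
    constructor <;> simpa using hL
  · rw [if_neg hs, if_neg (mt hiff.2 hs)]
    exact near_shift hA hB hAn hBn hlab h₀ hAB

/-- A bounded subset of `ℝ` split into uniformly separated order-convex pieces, the fibres of `c`,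
has a Lipschitz retraction from `X(n)` onto `X(n-1)`. -/
theorem exists_isLipschitzRetraction (hbdd : Bornology.IsBounded X) (hd : 0 < d)
    (hsep : ∀ x ∈ X, ∀ y ∈ X, |x - y| < d → c x = c y)
    (hX : ∀ x ∈ X, ∀ y ∈ X, c x = c y → Icc x y ⊆ X) (hn : 2 ≤ n) :
    ∃ (L : ℝ) (r : Set ℝ → Set ℝ), IsLipschitzRetraction X n (n - 1) L r := by
  rcases X.eq_empty_or_nonempty with rfl | ⟨x₀, hx₀⟩
  · have hemp : ∀ k A, ¬ MemFinSubsetSpace (∅ : Set ℝ) k A :=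
      fun k A hA => (hA.2.1.mono hA.2.2.2).ne_empty rfl
    exact ⟨0, id, fun A hA => (hemp _ _ hA).elim, fun _ _ => rfl,
      fun A _ hA => (hemp _ _ hA).elim⟩
  have hD : 0 ≤ Metric.diam X := Metric.diam_nonneg
  refine ⟨(1 + 4 * n) + Metric.diam X / d, collapse c n x₀,
    fun A hA => memFinSubsetSpace_collapse hx₀ hn hX hA, fun A hA => collapse_eq_self hn hA, ?_⟩
  intro A B hA hB
  have h₀ : 0 ≤ Metric.hausdorffDist A B := Metric.hausdorffDist_nonneg
  have hrA := memFinSubsetSpace_collapse hx₀ hn hX hA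
  have hrB := memFinSubsetSpace_collapse hx₀ hn hX hB
  rw [add_mul]
  rcases lt_or_ge (Metric.hausdorffDist A B) d with hlt | hge
  · have hnear := near_collapse (c := c) (x₀ := x₀) hA.1 hB.1 hA.2.2.1 hB.2.2.1
      (fun x hx y hy hxy => hsep x (hA.2.2.2 hx) y (hB.2.2.2 hy) (hxy.trans_lt hlt)) h₀
      (near_hausdorffDist hA.1 hB.1 hA.2.1 hB.2.1)
    exact (hnear.hausdorffDist_le (by positivity)).trans (le_add_of_nonneg_right (by positivity))
  · have hnear : Near (collapse c n x₀ A) (collapse c n x₀ B) (Metric.diam X) := by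
      constructor
      · intro x hx
        obtain ⟨y, hy⟩ := hrB.2.1
        exact ⟨y, hy, Metric.dist_le_diam_of_mem hbdd (hrA.2.2.2 hx) (hrB.2.2.2 hy)⟩
      · intro x hx
        obtain ⟨y, hy⟩ := hrA.2.1
        exact ⟨y, hy, Metric.dist_le_diam_of_mem hbdd (hrB.2.2.2 hx) (hrA.2.2.2 hy)⟩
    calc Metric.hausdorffDist (collapse c n x₀ A) (collapse c n x₀ B)
        ≤ Metric.diam X := hnear.hausdorffDist_le hD
      _ = Metric.diam X / d * d := by field_simp
      _ ≤ Metric.diam X / d * Metric.hausdorffDist A B := by gcongr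
      _ ≤ _ := le_add_of_nonneg_left (by positivity)

lemma exists_pos_separation {m : ℕ} {a b : Fin m → ℝ} (hab : ∀ i, a i ≤ b i)
    (hdisj : Pairwise fun i j => Disjoint (Icc (a i) (b i)) (Icc (a j) (b j))) :
    ∃ d > 0, ∀ i j, ∀ x ∈ Icc (a i) (b i), ∀ y ∈ Icc (a j) (b j), |x - y| < d → i = j := by
  have hpair : ∀ p : Fin m × Fin m, ∀ᶠ d in nhdsWithin (0 : ℝ) (Ioi 0),
      ∀ x ∈ Icc (a p.1) (b p.1), ∀ y ∈ Icc (a p.2) (b p.2), |x - y| < d → p.1 = p.2 := by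
    rintro ⟨i, j⟩
    by_cases hij : i = j
    · exact Filter.Eventually.of_forall fun _ _ _ _ _ _ => hij
    have hpos : 0 < max (a j - b i) (a i - b j) := by
      by_contra! hle
      have h₁ := (le_max_left _ _).trans hle
      have h₂ := (le_max_right _ _).trans hle
      exact disjoint_left.1 (hdisj hij)
        (show max (a i) (a j) ∈ _ from ⟨le_max_left _ _, max_le (hab i) (by linarith)⟩)
        ⟨le_max_right _ _, max_le (by linarith) (hab j)⟩
    filter_upwards [Ioo_mem_nhdsGT hpos] with d hd x hx y hy hxy
    have := abs_lt.1 hxy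
    have h₁ : a j - b i ≤ y - x := by linarith [hx.2, hy.1]
    have h₂ : a i - b j ≤ x - y := by linarith [hx.1, hy.2]
    rcases lt_max_iff.1 hd.2 with h | h <;> linarith
  obtain ⟨d, hd, hd₀⟩ := ((Filter.eventually_all.2 hpair).and self_mem_nhdsWithin).exists
  exact ⟨d, hd₀, fun i j => hd (i, j)⟩

end LipschitzClustering

/-- Theorem 4.5: a finite union `X ⊆ ℝ` of pairwise disjoint nonempty compact intervals
(some possibly degenerate) has the Lipschitz Clustering Property: for every `n ≥ 2`
there is a Lipschitz retraction from `X(n)` onto `X(n-1)`. -/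
theorem finite_union_of_intervals_LCP (m : ℕ) (a b : Fin m → ℝ) (hab : ∀ i, a i ≤ b i)
    (hdisj : Pairwise fun i j => Disjoint (Set.Icc (a i) (b i)) (Set.Icc (a j) (b j)))
    (X : Set ℝ) (hX : X = ⋃ i, Set.Icc (a i) (b i)) :
    ∀ n : ℕ, 2 ≤ n → ∃ (L : ℝ) (r : Set ℝ → Set ℝ),
      IsLipschitzRetraction X n (n - 1) L r := by
  intro n hn
  obtain ⟨d, hd, hsep⟩ := LipschitzClustering.exists_pos_separation hab hdisj
  subst hX
  refine LipschitzClustering.exists_isLipschitzRetraction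
    (c := fun x => {i | x ∈ Set.Icc (a i) (b i)}) ?_ hd ?_ ?_ hn
  · exact (isCompact_iUnion fun i => isCompact_Icc).isBounded
  · intro x hx y hy hxy
    obtain ⟨i, hi⟩ := Set.mem_iUnion.1 hx
    obtain ⟨j, hj⟩ := Set.mem_iUnion.1 hy
    obtain rfl := hsep i j x hi y hj hxy
    have huniq : ∀ z ∈ Set.Icc (a i) (b i), {k | z ∈ Set.Icc (a k) (b k)} = {i} := by
      intro z hz
      ext k
      refine ⟨fun hk => hsep k i z hk z hz (by simpa using hd), ?_⟩
      rintro rfl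
      exact hz
    exact (huniq x hi).trans (huniq y hj).symm
  · intro x hx y _ hxy z hz
    obtain ⟨i, hi⟩ := Set.mem_iUnion.1 hx
    have hi' : y ∈ Set.Icc (a i) (b i) := (Set.ext_iff.1 hxy i).1 hi
    exact Set.mem_iUnion.2 ⟨i, hi.1.trans hz.1, hz.2.trans hi'.2⟩
end

section
/- Let X = {0} ∪ {1/k : k ∈ ℕ, k ≥ 1} with the metric inherited from ℝ. Then there exists no Lipschitz retraction from X(4) onto X(3); in particular, X does not have the Lipschitz Clustering Property. -/
/-- The subset `Y ⊆ X` has the Lipschitz Clustering Property: for every `n ≥ 2` there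
is a Lipschitz retraction from `Y(n)` onto `Y(n-1)`. -/
def HasLCP {X : Type*} [MetricSpace X] (Y : Set X) : Prop :=
  ∀ n : ℕ, 2 ≤ n → ∃ (L : ℝ) (r : Set X → Set X), IsLipschitzRetraction Y n (n - 1) L r

/-- The set `X = {0} ∪ {1/k : k ∈ ℕ, k ≥ 1}`. -/
def seqSpace : Set ℝ := insert 0 {x : ℝ | ∃ k : ℕ, 1 ≤ k ∧ x = 1 / (k : ℝ)}

lemma zero_mem_seqSpace : (0 : ℝ) ∈ seqSpace := Set.mem_insert _ _

lemma one_div_mem_seqSpace {k : ℕ} (hk : 1 ≤ k) : 1 / (k : ℝ) ∈ seqSpace :=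
  Set.mem_insert_of_mem _ ⟨k, hk, rfl⟩

/-- The point `1 / k` of `seqSpace` is at distance at least `1 / (k (k + 1))` from all others. -/
lemma eq_one_div_of_abs_sub_lt {x : ℝ} (hx : x ∈ seqSpace) {k : ℕ} (hk : 1 ≤ k)
    (h : |x - 1 / (k : ℝ)| < 1 / ((k : ℝ) * (k + 1))) : x = 1 / (k : ℝ) := by
  have hk0 : (0 : ℝ) < k := by exact_mod_cast hk
  have hgap : 1 / (k : ℝ) - 1 / (k + 1) = 1 / ((k : ℝ) * (k + 1)) := by field_simp; ring
  rw [abs_lt] at h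
  rcases hx with rfl | ⟨j, hj, rfl⟩
  · have : 0 < 1 / ((k : ℝ) + 1) := by positivity
    linarith [h.1]
  · have hj0 : (0 : ℝ) < j := by exact_mod_cast hj
    rcases lt_trichotomy j k with hjk | rfl | hjk
    · exfalso
      have h1 : (j : ℝ) + 1 ≤ k := by exact_mod_cast hjk
      have h2 : 1 / ((j : ℝ) * (j + 1)) ≤ 1 / (j : ℝ) - 1 / k := by
        have h3 : 1 / (j : ℝ) - 1 / (j + 1) = 1 / ((j : ℝ) * (j + 1)) := by field_simp; ring
        have h4 : 1 / (k : ℝ) ≤ 1 / (j + 1) := one_div_le_one_div_of_le (by positivity) h1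
        linarith
      have h5 : 1 / ((k : ℝ) * (k + 1)) ≤ 1 / ((j : ℝ) * (j + 1)) :=
        one_div_le_one_div_of_le (by positivity) (by nlinarith)
      linarith [h.2]
    · rfl
    · exfalso
      have h1 : (k : ℝ) + 1 ≤ j := by exact_mod_cast hjk
      have h4 : 1 / (j : ℝ) ≤ 1 / (k + 1) := one_div_le_one_div_of_le (by positivity) h1
      linarith [h.1]

lemma MemFinSubsetSpace.exists_abs_sub_lt {Y A B : Set ℝ} {m n : ℕ}
    (hA : MemFinSubsetSpace Y m A) (hB : MemFinSubsetSpace Y n B) {δ x : ℝ} (hx : x ∈ A)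
    (h : Metric.hausdorffDist A B < δ) : ∃ y ∈ B, |x - y| < δ := by
  obtain ⟨y, hy, hxy⟩ := Metric.exists_dist_lt_of_hausdorffDist_lt hx h
    (Metric.hausdorffEDist_ne_top_of_nonempty_of_bounded hA.2.1 hB.2.1
      hA.1.isBounded hB.1.isBounded)
  exact ⟨y, hy, by rwa [Real.dist_eq] at hxy⟩

lemma hausdorffDist_insert_insert_le (s : Set ℝ) (a b : ℝ) :
    Metric.hausdorffDist (insert a s) (insert b s) ≤ |a - b| := by
  refine Metric.hausdorffDist_le_of_mem_dist (abs_nonneg _) ?_ ?_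
  · rintro x (rfl | hx)
    · exact ⟨b, Set.mem_insert _ _, (Real.dist_eq _ _).le⟩
    · exact ⟨x, Set.mem_insert_of_mem _ hx, by simp⟩
  · rintro x (rfl | hx)
    · exact ⟨a, Set.mem_insert _ _, by rw [dist_comm, Real.dist_eq]⟩
    · exact ⟨x, Set.mem_insert_of_mem _ hx, by simp⟩

lemma memFinSubsetSpace_quadruple {Y : Set ℝ} {a b c d : ℝ} (ha : a ∈ Y) (hb : b ∈ Y)
    (hc : c ∈ Y) (hd : d ∈ Y) : MemFinSubsetSpace Y 4 {a, b, c, d} := by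
  refine ⟨Set.toFinite _, Set.insert_nonempty _ _, ?_, ?_⟩
  · exact_mod_cast Finset.card_le_four (a := a) (b := b) (c := c) (d := d) |>.trans' (by
      rw [← Set.ncard_coe_finset]; simp)
  · rintro x (rfl | rfl | rfl | rfl) <;> assumption

lemma memFinSubsetSpace_triple {Y : Set ℝ} {a b c : ℝ} (ha : a ∈ Y) (hb : b ∈ Y)
    (hc : c ∈ Y) : MemFinSubsetSpace Y 3 {a, b, c} := by
  refine ⟨Set.toFinite _, Set.insert_nonempty _ _, ?_, ?_⟩
  · exact_mod_cast Finset.card_le_three (a := a) (b := b) (c := c) |>.trans' (by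
      rw [← Set.ncard_coe_finset]; simp)
  · rintro x (rfl | rfl | rfl) <;> assumption

/-- An isolated point of `r A` persists in `r B` when `B` is close enough to `A`. -/
lemma IsLipschitzRetraction.one_div_mem {m n : ℕ} {L : ℝ} {r : Set ℝ → Set ℝ}
    (hr : IsLipschitzRetraction seqSpace n m L r) {A B : Set ℝ}
    (hA : MemFinSubsetSpace seqSpace n A) (hB : MemFinSubsetSpace seqSpace n B) {k : ℕ}
    (hk : 1 ≤ k) (h : L * Metric.hausdorffDist A B < 1 / ((k : ℝ) * (k + 1)))
    (hmem : 1 / (k : ℝ) ∈ r A) : 1 / (k : ℝ) ∈ r B := by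
  obtain ⟨y, hy, hlt⟩ := (hr.1 A hA).exists_abs_sub_lt (hr.1 B hB) hmem
    ((hr.2.2 A B hA hB).trans_lt h)
  rw [abs_sub_comm] at hlt
  rwa [← eq_one_div_of_abs_sub_lt ((hr.1 B hB).2.2.2 hy) hk hlt]

/-- A point `1 / k` of the limit set `{0, p, q}` lies in `r {1 / m, 0, p, q}` for all `m ≥ M`,
provided that consecutive points `1 / m` with `m ≥ M` are close enough together. -/
lemma IsLipschitzRetraction.one_div_mem_of_limit {L : ℝ} (hL : 0 ≤ L) {r : Set ℝ → Set ℝ}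
    (hr : IsLipschitzRetraction seqSpace 4 3 L r) {p q : ℝ} (hp : p ∈ seqSpace)
    (hq : q ∈ seqSpace) {k M : ℕ} (hk : 1 ≤ k) (hM : 1 ≤ M)
    (hpq : 1 / (k : ℝ) = p ∨ 1 / (k : ℝ) = q)
    (hstep : L * (1 / (M : ℝ) ^ 2) < 1 / ((k : ℝ) * (k + 1))) :
    ∀ m, M ≤ m → 1 / (k : ℝ) ∈ r {1 / (m : ℝ), 0, p, q} := by
  have hmem : ∀ m : ℕ, M ≤ m → MemFinSubsetSpace seqSpace 4 {1 / (m : ℝ), 0, p, q} := fun m hm =>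
    memFinSubsetSpace_quadruple (one_div_mem_seqSpace (hM.trans hm)) zero_mem_seqSpace hp hq
  have hk0 : (0 : ℝ) < k := by exact_mod_cast hk
  have hM0 : (0 : ℝ) < M := by exact_mod_cast hM
  have hpos : 0 < 1 / ((k : ℝ) * (k + 1)) := by positivity
  obtain ⟨N, hN⟩ := exists_nat_gt (L / (1 / ((k : ℝ) * (k + 1))))
  have key : ∀ d m : ℕ, M ≤ m → N ≤ m + d → 1 / (k : ℝ) ∈ r {1 / (m : ℝ), 0, p, q} := by
    intro d
    induction d with
    | zero =>
      intro m hm hNm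
      have hm0 : (0 : ℝ) < m := hM0.trans_le (by exact_mod_cast hm)
      refine hr.one_div_mem (A := {0, 0, p, q})
        (memFinSubsetSpace_quadruple zero_mem_seqSpace zero_mem_seqSpace hp hq) (hmem m hm) hk ?_ ?_
      · have h1 := hausdorffDist_insert_insert_le {0, p, q} 0 (1 / (m : ℝ))
        rw [zero_sub, abs_neg, abs_of_pos (by positivity)] at h1
        refine (mul_le_mul_of_nonneg_left h1 hL).trans_lt ?_
        have h2 : L / (1 / ((k : ℝ) * (k + 1))) < m :=
          hN.trans_le (by exact_mod_cast hNm)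
        rw [div_lt_iff₀ hpos] at h2
        rw [mul_one_div, div_lt_iff₀ hm0]
        linarith
      · rw [Set.insert_idem, hr.2.1 _ (memFinSubsetSpace_triple zero_mem_seqSpace hp hq)]
        rcases hpq with h | h <;> simp [h]
    | succ d ih =>
      intro m hm hNm
      have hmM : (M : ℝ) ≤ m := by exact_mod_cast hm
      have hm0 : (0 : ℝ) < m := hM0.trans_le hmM
      refine hr.one_div_mem (hmem (m + 1) (by omega)) (hmem m hm) hk ?_
        (ih (m + 1) (by omega) (by omega))
      have h1 := hausdorffDist_insert_insert_le {0, p, q} (1 / ((m + 1 : ℕ) : ℝ)) (1 / (m : ℝ))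
      have h2 : |1 / ((m + 1 : ℕ) : ℝ) - 1 / (m : ℝ)| ≤ 1 / (M : ℝ) ^ 2 := by
        have h3 : 1 / (m : ℝ) - 1 / ((m + 1 : ℕ) : ℝ) = 1 / ((m : ℝ) * (m + 1)) := by
          push_cast; field_simp; ring
        rw [abs_sub_comm, h3, abs_of_pos (by positivity)]
        exact one_div_le_one_div_of_le (by positivity) (by nlinarith)
      exact (mul_le_mul_of_nonneg_left (h1.trans h2) hL).trans_lt hstep
  exact fun m hm => key N m hm (by omega)

lemma IsLipschitzRetraction.mono {X : Type*} [MetricSpace X] {Y : Set X} {m n : ℕ} {L L' : ℝ}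
    {r : Set X → Set X} (hr : IsLipschitzRetraction Y n m L r) (h : L ≤ L') :
    IsLipschitzRetraction Y n m L' r :=
  ⟨hr.1, hr.2.1, fun A B hA hB =>
    (hr.2.2 A B hA hB).trans (mul_le_mul_of_nonneg_right h Metric.hausdorffDist_nonneg)⟩

lemma not_isLipschitzRetraction_seqSpace (L : ℝ) (r : Set ℝ → Set ℝ) :
    ¬ IsLipschitzRetraction seqSpace 4 3 L r := by
  intro hrL
  obtain ⟨C, hC1, hLC⟩ : ∃ C : ℕ, 1 ≤ C ∧ L ≤ C := by
    obtain ⟨C, hC⟩ := exists_nat_ge L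
    exact ⟨C + 1, by omega, by push_cast; linarith⟩
  have hr := hrL.mono hLC
  have hc : (1 : ℝ) ≤ C := by exact_mod_cast hC1
  obtain ⟨n, hn⟩ : ∃ n : ℕ, n = 6 * C ^ 2 := ⟨_, rfl⟩
  obtain ⟨M, hM⟩ : ∃ M : ℕ, M = 2 * C * (n + 1) := ⟨_, rfl⟩
  have hn' : (n : ℝ) = 6 * (C : ℝ) ^ 2 := by exact_mod_cast hn
  have hM' : (M : ℝ) = 2 * C * (n + 1) := by exact_mod_cast hM
  have hn1 : 1 ≤ n := by rw [hn]; nlinarith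
  have hM1 : 1 ≤ M := by rw [hM]; nlinarith
  have hnC : 6 * (C : ℝ) ≤ n := by rw [hn']; nlinarith
  have hn0 : (0 : ℝ) < n := by linarith
  have hM0 : (0 : ℝ) < M := by rw [hM']; positivity
  have hgap : 1 / (n : ℝ) - 1 / ((n + 1 : ℕ) : ℝ) = 1 / ((n : ℝ) * (n + 1)) := by
    push_cast; field_simp; ring
  have hgM : (C : ℝ) * (1 / ((n : ℝ) * (n + 1))) = 1 / (3 * M) := by
    rw [hM', hn']; field_simp; ring
  have hp := one_div_mem_seqSpace hn1
  have hq := one_div_mem_seqSpace (k := n + 1) (by omega)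
  have hMX := one_div_mem_seqSpace hM1
  have hstep : (C : ℝ) * (1 / (M : ℝ) ^ 2) < 1 / (((n : ℝ) + 1) * (n + 2)) := by
    rw [mul_one_div, div_lt_div_iff₀ (by positivity) (by positivity), hM']
    have : (n : ℝ) + 2 < 4 * C * (n + 1) := by nlinarith
    have h2 : 0 < (C : ℝ) * (n + 1) := by positivity
    nlinarith
  have hpmem : 1 / (n : ℝ) ∈ r {1 / (M : ℝ), 0, 1 / (n : ℝ), 1 / ((n + 1 : ℕ) : ℝ)} := by
    refine hr.one_div_mem_of_limit (by positivity) hp hq hn1 hM1 (Or.inl rfl) ?_ M le_rfl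
    exact hstep.trans_le (one_div_le_one_div_of_le (by positivity) (by nlinarith))
  have hqmem : 1 / ((n + 1 : ℕ) : ℝ) ∈
      r {1 / (M : ℝ), 0, 1 / (n : ℝ), 1 / ((n + 1 : ℕ) : ℝ)} := by
    refine hr.one_div_mem_of_limit (by positivity) hp hq (by omega) hM1 (Or.inr rfl) ?_ M le_rfl
    refine hstep.trans_le (le_of_eq ?_)
    push_cast; ring
  have hA := memFinSubsetSpace_quadruple hMX zero_mem_seqSpace hp hq
  have hB := memFinSubsetSpace_triple hp hMX zero_mem_seqSpace
  have hB4 := memFinSubsetSpace_quadruple hp hp hMX zero_mem_seqSpace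
  set A : Set ℝ := {1 / (M : ℝ), 0, 1 / (n : ℝ), 1 / ((n + 1 : ℕ) : ℝ)} with hAdef
  have hAeq : A = insert (1 / ((n + 1 : ℕ) : ℝ)) {1 / (n : ℝ), 1 / (M : ℝ), 0} := by
    rw [hAdef]; ext x; simp only [Set.mem_insert_iff, Set.mem_singleton_iff]; tauto
  rw [Set.insert_idem] at hB4
  have hdist : Metric.hausdorffDist {1 / (n : ℝ), 1 / (M : ℝ), 0} (r A) < 1 / (2 * M) := by
    have h1 := hausdorffDist_insert_insert_le {1 / (n : ℝ), 1 / (M : ℝ), 0} (1 / (n : ℝ))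
      (1 / ((n + 1 : ℕ) : ℝ))
    rw [Set.insert_idem, ← hAeq, hgap, abs_of_pos (by positivity)] at h1
    have h2 := hr.2.2 _ _ hB4 hA
    rw [hr.2.1 _ hB] at h2
    have h3 : (C : ℝ) * Metric.hausdorffDist {1 / (n : ℝ), 1 / (M : ℝ), 0} A ≤ 1 / (3 * M) :=
      hgM ▸ mul_le_mul_of_nonneg_left h1 (by positivity)
    refine (h2.trans h3).trans_lt ?_
    exact one_div_lt_one_div_of_lt (by positivity) (by linarith)
  have hrA := hr.1 A hA
  obtain ⟨y, hy, hy0⟩ := hB.exists_abs_sub_lt hrA (x := 0) (by simp) hdist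
  obtain ⟨z, hz, hzM⟩ := hB.exists_abs_sub_lt hrA (x := 1 / (M : ℝ)) (by simp) hdist
  have hhalf : 1 / (M : ℝ) = 2 * (1 / (2 * M)) := by field_simp
  rw [abs_lt] at hy0 hzM
  have hyz : y < z := by linarith [hy0.1, hzM.2]
  have hzq : z < 1 / ((n + 1 : ℕ) : ℝ) := by
    have : 3 * (1 / (2 * (M : ℝ))) ≤ 1 / ((n + 1 : ℕ) : ℝ) := by
      rw [mul_one_div, div_le_div_iff₀ (by positivity) (by positivity), hM']
      push_cast
      nlinarith
    linarith [hzM.1]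
  have hqp : 1 / ((n + 1 : ℕ) : ℝ) < 1 / (n : ℝ) := by
    have : 0 < 1 / ((n : ℝ) * (n + 1)) := by positivity
    linarith
  have hsub : (({y, z, 1 / ((n + 1 : ℕ) : ℝ), 1 / (n : ℝ)} : Finset ℝ) : Set ℝ) ⊆ r A := by
    intro x hx
    simp only [Finset.coe_insert, Finset.coe_singleton, Set.mem_insert_iff,
      Set.mem_singleton_iff] at hx
    rcases hx with rfl | rfl | rfl | rfl <;> assumption
  have hcard := (Set.ncard_le_ncard hsub hrA.1).trans hrA.2.2.1
  rw [Set.ncard_coe_finset, Finset.card_insert_of_notMem, Finset.card_insert_of_notMem,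
    Finset.card_pair hqp.ne] at hcard
  · omega
  · simp only [Finset.mem_insert, Finset.mem_singleton, not_or]
    exact ⟨hzq.ne, (hzq.trans hqp).ne⟩
  · simp only [Finset.mem_insert, Finset.mem_singleton, not_or]
    exact ⟨hyz.ne, (hyz.trans hzq).ne, (hyz.trans (hzq.trans hqp)).ne⟩

/-- Proposition 4.6(b): for `X = {0} ∪ {1/k : k ≥ 1}` there is no Lipschitz retraction
from `X(4)` onto `X(3)`; in particular `X` does not have the Lipschitz Clustering
Property. -/
theorem seqSpace_no_lipschitz_retraction :
    (¬ ∃ (L : ℝ) (r : Set ℝ → Set ℝ), IsLipschitzRetraction seqSpace 4 3 L r) ∧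
    ¬ HasLCP seqSpace := by
  have h : ¬ ∃ (L : ℝ) (r : Set ℝ → Set ℝ), IsLipschitzRetraction seqSpace 4 3 L r := by
    rintro ⟨L, r, hr⟩
    exact not_isLipschitzRetraction_seqSpace L r hr
  exact ⟨h, fun hLCP => h (hLCP 4 (by norm_num))⟩
end

section
/- Suppose a metric space (X, d) supports an L-Lipschitz retraction r : X(4) → X(3) (with respect to the Hausdorff metric) and the interval [0,1] admits an L-bi-Lipschitz embedding into X. Then there exist positive constants r₀ and M depending only on L (one may take r₀ = 1/(48(L+1)^5) and M = 4L²(L+1)²) such that any two points p, q ∈ X with d(p,q) ≤ r₀ can be connected by a curve in X of length at most M·d(p,q). -/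
open scoped NNReal

theorem exists_selection_lipschitzOnWith_finset {X : Type*} [MetricSpace X]
    {A : ℝ≥0 → Set X} {C : ℝ≥0}
    (hA : ∀ s t, ∀ a ∈ A s, ∃ b ∈ A t, dist a b ≤ C * dist s t) {p : X} (hp : p ∈ A 0)
    (F : Finset ℝ≥0) :
    ∃ f : ℝ≥0 → X, (∀ t, f t ∈ A t) ∧ f 0 = p ∧
      LipschitzOnWith C f (insert 0 (F : Set ℝ≥0)) := by
  classical
  induction F using Finset.induction_on_max with
  | empty =>
    choose f hf hfd using fun t ↦ hA 0 t p hp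
    exact ⟨f, hf, (dist_le_zero.1 (by simpa using hfd 0)).symm,
      by simpa using LipschitzOnWith.of_dist_le_mul (by simp)⟩
  | insert a s hs ih =>
    obtain ⟨f, hfA, hf0, hf⟩ := ih
    rcases eq_or_ne a 0 with rfl | ha
    · exact ⟨f, hfA, hf0, by simpa using hf⟩
    have hs' : ∀ x ∈ insert 0 s, x < a := by
      simpa [pos_iff_ne_zero.2 ha] using hs
    set m := (insert 0 s).max' (Finset.insert_nonempty _ _)
    have hm : m ∈ insert 0 s := Finset.max'_mem _ _
    obtain ⟨b, hb, hbd⟩ := hA m a (f m) (hfA m)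
    have key : ∀ x ∈ insert 0 s, dist (f x) b ≤ C * dist x a := by
      intro x hx
      have hxm : x ≤ m := Finset.le_max' _ _ hx
      have hsum : dist x a = dist x m + dist m a := by
        have h1 : (x : ℝ) ≤ m := hxm
        have h2 : (m : ℝ) ≤ a := (hs' m hm).le
        simp only [NNReal.dist_eq]
        rw [abs_of_nonpos (by linarith), abs_of_nonpos (by linarith), abs_of_nonpos (by linarith)]
        ring
      have := hf.dist_le_mul x (by simpa using hx) m (by simpa using hm)
      calc dist (f x) b ≤ dist (f x) (f m) + dist (f m) b := dist_triangle _ _ _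
        _ ≤ C * dist x m + C * dist m a := add_le_add this hbd
        _ = C * dist x a := by rw [hsum]; ring
    refine ⟨Function.update f a b, fun t ↦ ?_, by simp [ha.symm, hf0], ?_⟩
    · rcases eq_or_ne t a with rfl | hta
      · simpa using hb
      · simpa [hta] using hfA t
    · have hset : (insert 0 ((insert a s : Finset ℝ≥0) : Set ℝ≥0)) =
          insert a ((insert 0 s : Finset ℝ≥0) : Set ℝ≥0) := by
        push_cast
        exact Set.insert_comm _ _ _
      rw [hset]
      refine LipschitzOnWith.of_dist_le_mul ?_
      rintro x (rfl | hx) y (rfl | hy)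
      · simp
      · have hy' := Finset.mem_coe.1 hy
        simpa [(hs' y hy').ne, dist_comm] using key y hy'
      · have hx' := Finset.mem_coe.1 hx
        simpa [(hs' x hx').ne] using key x hx'
      · have hx' := Finset.mem_coe.1 hx
        have hy' := Finset.mem_coe.1 hy
        simpa [(hs' x hx').ne, (hs' y hy').ne] using
          hf.dist_le_mul x (by simpa using hx') y (by simpa using hy')

/-- A Lipschitz path of finite sets has a Lipschitz selection through every point of its
initial set. -/
theorem exists_lipschitzWith_selection {X : Type*} [MetricSpace X]
    {A : ℝ≥0 → Set X} {C : ℝ≥0} (hfin : ∀ t, (A t).Finite)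
    (hA : ∀ s t, ∀ a ∈ A s, ∃ b ∈ A t, dist a b ≤ C * dist s t) {p : X} (hp : p ∈ A 0) :
    ∃ f : ℝ≥0 → X, (∀ t, f t ∈ A t) ∧ f 0 = p ∧ LipschitzWith C f := by
  have (t : ℝ≥0) : Finite (A t) := hfin t
  choose g hgA hg0 hg using exists_selection_lipschitzOnWith_finset hA hp
  obtain ⟨f, hf⟩ := Finset.rado_selection (β := fun t ↦ A t) fun F t ↦ ⟨g F t, hgA F t⟩
  refine ⟨fun t ↦ f t, fun t ↦ (f t).2, ?_, LipschitzWith.of_dist_le_mul fun s t ↦ ?_⟩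
  · obtain ⟨F, -, hF⟩ := hf {0}
    simp [hF 0 (by simp), hg0]
  · obtain ⟨F, hsub, hF⟩ := hf {s, t}
    rw [hF s (by simp), hF t (by simp)]
    exact (hg F).dist_le_mul s (Or.inr (hsub (by simp))) t (Or.inr (hsub (by simp)))

/-- Two Lipschitz curves with a common value at time `T` can be concatenated. -/
theorem exists_curve_of_lipschitzWith {X : Type*} [PseudoMetricSpace X] {C T : ℝ≥0}
    {f g : ℝ≥0 → X} (hf : LipschitzWith C f) (hg : LipschitzWith C g) (hT : f T = g T) :
    ∃ γ : ℝ → X, ContinuousOn γ (Set.Icc (0 : ℝ) 1) ∧ γ 0 = f 0 ∧ γ 1 = g 0 ∧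
      eVariationOn γ (Set.Icc (0 : ℝ) 1) ≤ ENNReal.ofReal (2 * C * T) := by
  set F : ℝ → X := fun x ↦ f (2 * T * x).toNNReal
  set G : ℝ → X := fun x ↦ g (2 * T * (1 - x)).toNNReal
  have hF (x y : ℝ) (h : x ≤ y) : dist (F x) (F y) ≤ 2 * C * T * (y - x) := by
    refine (hf.dist_le_mul _ _).trans ?_
    have h1 := Real.lipschitzWith_toNNReal.dist_le_mul (2 * T * x) (2 * T * y)
    have h2 : dist (2 * T * x) (2 * T * y) = 2 * T * (y - x) := by
      rw [Real.dist_eq, ← mul_sub, abs_mul, abs_sub_comm, abs_of_nonneg (sub_nonneg.2 h),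
        abs_of_nonneg (by positivity)]
    rw [h2, NNReal.coe_one, one_mul] at h1
    exact (mul_le_mul_of_nonneg_left h1 C.2).trans (by rw [NNReal.val_eq_coe]; linarith)
  have hG (x y : ℝ) (h : x ≤ y) : dist (G x) (G y) ≤ 2 * C * T * (y - x) := by
    refine (hg.dist_le_mul _ _).trans ?_
    have h1 := Real.lipschitzWith_toNNReal.dist_le_mul (2 * T * (1 - x)) (2 * T * (1 - y))
    have h2 : dist (2 * T * (1 - x)) (2 * T * (1 - y)) = 2 * T * (y - x) := by
      rw [Real.dist_eq, ← mul_sub, abs_mul, sub_sub_sub_cancel_left,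
        abs_of_nonneg (sub_nonneg.2 h), abs_of_nonneg (by positivity)]
    rw [h2, NNReal.coe_one, one_mul] at h1
    exact (mul_le_mul_of_nonneg_left h1 C.2).trans (by rw [NNReal.val_eq_coe]; linarith)
  have hFG : F (1 / 2) = G (1 / 2) := by
    have h1 : (2 * T * (1 / 2) : ℝ) = T := by ring
    have h2 : (2 * T * (1 - 1 / 2) : ℝ) = T := by ring
    simp only [F, G, h1, h2, Real.toNNReal_coe, hT]
  set γ : ℝ → X := fun x ↦ if x ≤ 1 / 2 then F x else G x with hγ
  have hdist (x y : ℝ) (h : x ≤ y) : dist (γ x) (γ y) ≤ 2 * C * T * (y - x) := by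
    by_cases hy : y ≤ 1 / 2
    · simpa only [hγ, h.trans hy, hy, if_true] using hF x y h
    by_cases hx : x ≤ 1 / 2
    · simp only [hγ, hx, hy, if_true, if_false]
      have h1 := hF x (1 / 2) hx
      have h2 := hG (1 / 2) y (not_le.1 hy).le
      rw [hFG] at h1
      calc dist (F x) (G y) ≤ dist (F x) (G (1 / 2)) + dist (G (1 / 2)) (G y) :=
            dist_triangle _ _ _
        _ ≤ 2 * C * T * (y - x) := by linarith
    · simpa only [hγ, hx, hy, if_false] using hG x y h
  have hlip : LipschitzWith (2 * C * T) γ := by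
    refine LipschitzWith.of_dist_le_mul fun x y ↦ ?_
    push_cast
    rcases le_total x y with h | h
    · rw [Real.dist_eq, abs_sub_comm, abs_of_nonneg (sub_nonneg.2 h)]
      exact hdist x y h
    · rw [dist_comm, Real.dist_eq, abs_of_nonneg (sub_nonneg.2 h)]
      exact hdist y x h
  refine ⟨γ, hlip.continuous.continuousOn, by simp [hγ, F], ?_, ?_⟩
  · have : ¬ (1 : ℝ) ≤ 1 / 2 := by norm_num
    simp only [hγ, this, if_false, G]
    simp
  · refine ((hlip.lipschitzOnWith (s := Set.univ)).comp_eVariationOn_le (g := id)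
      (s := Set.Icc (0 : ℝ) 1) (Set.mapsTo_univ _ _)).trans ?_
    have h1 : eVariationOn (id : ℝ → ℝ) (Set.Icc 0 1) ≤ 1 := by simp
    calc _ ≤ ((2 * C * T : ℝ≥0) : ENNReal) * 1 := by gcongr
      _ = ENNReal.ofReal (2 * C * T) := by
        rw [mul_one, ← ENNReal.ofReal_coe_nnreal]
        push_cast
        rfl

theorem Set.Finite.exists_dist_le_of_hausdorffDist_le {X : Type*} [PseudoMetricSpace X]
    {A B : Set X} (hA : A.Finite) (hB : B.Finite) (hne : B.Nonempty) {c : ℝ}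
    (h : Metric.hausdorffDist A B ≤ c) {a : X} (ha : a ∈ A) : ∃ b ∈ B, dist a b ≤ c := by
  obtain ⟨b, hb, hab⟩ := hB.isCompact.exists_infDist_eq_dist hne a
  refine ⟨b, hb, hab ▸ (Metric.infDist_le_hausdorffDist_of_mem ha ?_).trans h⟩
  exact Metric.hausdorffEDist_ne_top_of_nonempty_of_bounded ⟨a, ha⟩ hne hA.isBounded hB.isBounded

theorem hausdorffDist_insert_le_dist {X : Type*} [PseudoMetricSpace X] (p q : X) {B : Set X}
    (hp : p ∈ B) : Metric.hausdorffDist (insert q B) B ≤ dist p q := by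
  refine Metric.hausdorffDist_le_of_mem_dist dist_nonneg ?_ fun x hx ↦
    ⟨x, Or.inr hx, by simp⟩
  rintro x (rfl | hx)
  · exact ⟨p, hp, (dist_comm _ _).le⟩
  · exact ⟨x, hx, by simp⟩

theorem hausdorffDist_insert_insert_le_dist {X : Type*} [PseudoMetricSpace X] (x y : X)
    (B : Set X) : Metric.hausdorffDist (insert x B) (insert y B) ≤ dist x y := by
  refine Metric.hausdorffDist_le_of_mem_dist dist_nonneg ?_ ?_
  · rintro z (rfl | hz)
    · exact ⟨y, by simp, le_rfl⟩
    · exact ⟨z, Or.inr hz, by simp⟩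
  · rintro z (rfl | hz)
    · exact ⟨x, by simp, (dist_comm _ _).le⟩
    · exact ⟨z, Or.inr hz, by simp⟩

theorem memFinSubsetSpace_triple_s10 {X : Type*} (a b c : X) :
    MemFinSubsetSpace Set.univ 3 {a, b, c} := by
  refine ⟨Set.toFinite _, by simp, ?_, Set.subset_univ _⟩
  have h1 := Set.ncard_insert_le a {b, c}
  have h2 := Set.ncard_insert_le b {c}
  rw [Set.ncard_singleton] at h2
  omega

theorem MemFinSubsetSpace.insert {X : Type*} {n : ℕ} {A : Set X}
    (h : MemFinSubsetSpace Set.univ n A) (a : X) :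
    MemFinSubsetSpace Set.univ (n + 1) (insert a A) :=
  ⟨h.1.insert a, Set.insert_nonempty _ _,
    (Set.ncard_insert_le a A).trans (Nat.add_le_add_right h.2.2.1 1), Set.subset_univ _⟩

theorem MemFinSubsetSpace.mono {X : Type*} {Y : Set X} {m n : ℕ} {A : Set X}
    (h : MemFinSubsetSpace Y m A) (hmn : m ≤ n) : MemFinSubsetSpace Y n A :=
  ⟨h.1, h.2.1, h.2.2.1.trans hmn, h.2.2.2⟩

theorem exists_curve_of_dist_le {X : Type*} [MetricSpace X]
    {L : ℝ} (hL : 1 ≤ L)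
    {r : Set X → Set X} (hr : IsLipschitzRetraction (Set.univ : Set X) 4 3 L r)
    {Γ : ℝ → X}
    (hΓ : ∀ s ∈ Set.Icc (0 : ℝ) 1, ∀ t ∈ Set.Icc (0 : ℝ) 1,
      L⁻¹ * |s - t| ≤ dist (Γ s) (Γ t) ∧ dist (Γ s) (Γ t) ≤ L * |s - t|)
    {p q : X} (hpq : dist p q ≤ 1 / (48 * (L + 1) ^ 5)) (hp : 1 / (2 * L) ≤ dist p (Γ 0)) :
    ∃ γ : ℝ → X, ContinuousOn γ (Set.Icc (0 : ℝ) 1) ∧ γ 0 = p ∧ γ 1 = q ∧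
      eVariationOn γ (Set.Icc (0 : ℝ) 1) ≤
        ENNReal.ofReal (4 * L ^ 2 * (L + 1) ^ 2 * dist p q) := by
  rcases eq_or_ne p q with rfl | hne
  · exact ⟨fun _ ↦ p, continuousOn_const, rfl, rfl,
      by rw [eVariationOn.constant_on (by simp [Set.Subsingleton])]; exact zero_le⟩
  obtain ⟨hr1, hr2, hr3⟩ := hr
  have hL0 : 0 < L := by linarith
  set δ := dist p q
  have hδ0 : 0 < δ := dist_pos.2 hne
  have hδ1 : δ * (48 * (L + 1) ^ 5) ≤ 1 := (le_div_iff₀ (by positivity)).1 hpq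
  set T : ℝ≥0 := ⟨2 * (L + 1) ^ 2 * δ, by positivity⟩
  set C : ℝ≥0 := ⟨L ^ 2, by positivity⟩
  have hTr : (T : ℝ) = 2 * (L + 1) ^ 2 * δ := rfl
  have hCr : (C : ℝ) = L ^ 2 := rfl
  have hp' : 1 ≤ 2 * L * dist p (Γ 0) := by
    rw [div_le_iff₀ (by positivity)] at hp; linarith
  -- the parameter range stays inside `[0, 1]`, and `p` stays away from the image of `[0, T]`
  have hT1 : (T : ℝ) ≤ 1 := by
    rw [hTr]
    refine le_trans ?_ hδ1
    have h3 : (1 : ℝ) ≤ (L + 1) ^ 3 := one_le_pow₀ (by linarith)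
    have : (L + 1) ^ 2 * 1 ≤ (L + 1) ^ 2 * (L + 1) ^ 3 := by gcongr
    nlinarith
  have hsmall : (1 + L) * δ + (L ^ 2 + L) * T < dist p (Γ 0) := by
    have h1 : 2 * L * ((1 + L) * δ + (L ^ 2 + L) * T) < 1 := by
      have e : 2 * L * ((1 + L) * δ + (L ^ 2 + L) * T)
          = δ * (2 * L * (L + 1) + 4 * L ^ 2 * (L + 1) ^ 3) := by rw [hTr]; ring
      rw [e]
      refine lt_of_lt_of_le ?_ hδ1
      gcongr
      have a1 : L ≤ L + 1 := by linarith
      have a2 : (L + 1) ^ 2 ≤ (L + 1) ^ 5 := pow_le_pow_right₀ (by linarith) (by norm_num)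
      have a3 : L * (L + 1) ≤ (L + 1) ^ 2 := by nlinarith
      have a4 : L ^ 2 * (L + 1) ^ 3 ≤ (L + 1) ^ 2 * (L + 1) ^ 3 := by gcongr
      have a5 : (0 : ℝ) < (L + 1) ^ 5 := by positivity
      nlinarith
    have h2 : 2 * L * ((1 + L) * δ + (L ^ 2 + L) * T) < 2 * L * dist p (Γ 0) := h1.trans_le hp'
    exact lt_of_mul_lt_mul_left h2 (by positivity)
  -- the Lipschitz path of finite sets
  set c : ℝ≥0 → X := fun t ↦ Γ (min t 1 : ℝ≥0)
  have hmem (t : ℝ≥0) : ((min t 1 : ℝ≥0) : ℝ) ∈ Set.Icc (0 : ℝ) 1 :=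
    ⟨NNReal.coe_nonneg _, by exact_mod_cast min_le_right t 1⟩
  have hc (s t : ℝ≥0) : dist (c s) (c t) ≤ L * dist s t := by
    refine (hΓ _ (hmem s) _ (hmem t)).2.trans ?_
    gcongr
    push_cast
    simpa [NNReal.dist_eq] using abs_min_sub_min_le_max (s : ℝ) 1 t 1
  have hc0 : c 0 = Γ 0 := by simp [c]
  set B : ℝ≥0 → Set X := fun t ↦ {c t, p, Γ 0} with hB
  have hB3 (t : ℝ≥0) : MemFinSubsetSpace Set.univ 3 (B t) := memFinSubsetSpace_triple_s10 _ _ _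
  set A : ℝ≥0 → Set X := fun t ↦ r (insert q (B t)) with hAdef
  have hA3 (t : ℝ≥0) : MemFinSubsetSpace Set.univ 3 (A t) := hr1 _ ((hB3 t).insert q)
  have hA (s t : ℝ≥0) : ∀ a ∈ A s, ∃ b ∈ A t, dist a b ≤ C * dist s t := by
    intro a ha
    refine (hA3 s).1.exists_dist_le_of_hausdorffDist_le (hA3 t).1 (hA3 t).2.1 ?_ ha
    refine (hr3 _ _ ((hB3 s).insert q) ((hB3 t).insert q)).trans ?_
    rw [hCr, sq, mul_assoc]
    gcongr
    refine le_trans ?_ (hc s t)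
    simp only [hB, Set.insert_comm q (c _)]
    exact hausdorffDist_insert_insert_le_dist _ _ _
  have hA0 : A 0 = {q, p, Γ 0} := by
    have h : insert q (B 0) = {q, p, Γ 0} := by
      ext x; simp only [hB, hc0, Set.mem_insert_iff, Set.mem_singleton_iff]; tauto
    simp only [hAdef, h]
    exact hr2 _ (memFinSubsetSpace_triple_s10 _ _ _)
  obtain ⟨f, hfA, hf0, hf⟩ := exists_lipschitzWith_selection (fun t ↦ (hA3 t).1) hA (p := p)
    (by simp [hA0])
  obtain ⟨g, hgA, hg0, hg⟩ := exists_lipschitzWith_selection (fun t ↦ (hA3 t).1) hA (p := q)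
    (by simp [hA0])
  -- at time `T` there is a unique point near `p`, since two others are near `Γ 0` and `Γ T`
  have hBA : Metric.hausdorffDist (B T) (A T) ≤ L * δ := by
    have h := hr3 _ _ ((hB3 T).mono (by norm_num : 3 ≤ 4)) ((hB3 T).insert q)
    rw [hr2 _ (hB3 T)] at h
    refine h.trans ?_
    gcongr
    rw [Metric.hausdorffDist_comm]
    exact hausdorffDist_insert_le_dist p q (by simp [hB])
  obtain ⟨a, haA, ha⟩ := (hB3 T).1.exists_dist_le_of_hausdorffDist_le (hA3 T).1 (hA3 T).2.1 hBA
    (a := Γ 0) (by simp [hB])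
  obtain ⟨b, hbA, hb⟩ := (hB3 T).1.exists_dist_le_of_hausdorffDist_le (hA3 T).1 (hA3 T).2.1 hBA
    (a := c T) (by simp [hB])
  have hcT : c T = Γ T := by
    simp only [c]; rw [min_eq_left (by exact_mod_cast hT1)]
  have hcT_le : dist (Γ 0) (c T) ≤ L * T := by
    have := hc 0 T
    rwa [hc0, NNReal.dist_eq, NNReal.coe_zero, zero_sub, abs_neg, NNReal.abs_eq] at this
  have hcT_ge : 2 * L * δ < dist (Γ 0) (c T) := by
    have h := (hΓ 0 (by simp) T ⟨T.2, hT1⟩).1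
    rw [zero_sub, abs_neg, NNReal.abs_eq, ← hcT, inv_mul_le_iff₀ hL0] at h
    have h' : 2 * (L + 1) ^ 2 * δ ≤ L * dist (Γ 0) (c T) := h
    have : L * (2 * L * δ) < L * dist (Γ 0) (c T) := by nlinarith [mul_pos hL0 hδ0]
    exact lt_of_mul_lt_mul_left this hL0.le
  have hab : a ≠ b := by
    rintro rfl
    have := dist_triangle_right (Γ 0) (c T) a
    linarith
  have hfar (x : X) (hx : dist p x ≤ δ + L ^ 2 * T) : x ≠ a ∧ x ≠ b := by
    have hLT : 0 ≤ L * T := by positivity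
    constructor
    · rintro rfl
      have := dist_triangle_right p (Γ 0) x
      linarith
    · rintro rfl
      have h1 := dist_triangle_right p (c T) x
      have h2 := dist_triangle_right p (Γ 0) (c T)
      linarith
  have hfT : dist p (f T) ≤ δ + L ^ 2 * T := by
    have h := hf.dist_le_mul 0 T
    rw [hf0, hCr, NNReal.dist_eq, NNReal.coe_zero, zero_sub, abs_neg, NNReal.abs_eq] at h
    exact h.trans (le_add_of_nonneg_left hδ0.le)
  have hgT : dist p (g T) ≤ δ + L ^ 2 * T := by
    have h := hg.dist_le_mul 0 T
    rw [hg0, hCr, NNReal.dist_eq, NNReal.coe_zero, zero_sub, abs_neg, NNReal.abs_eq] at h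
    exact (dist_triangle p q _).trans (add_le_add_right h _)
  have hfg : f T = g T := by
    by_contra hfg
    have h := (Set.three_lt_ncard_iff (hA3 T).1).2 ⟨a, b, f T, g T, haA, hbA, hfA T, hgA T, hab,
      (hfar _ hfT).1.symm, (hfar _ hgT).1.symm, (hfar _ hfT).2.symm, (hfar _ hgT).2.symm, hfg⟩
    exact absurd h (not_lt.2 (hA3 T).2.2.1)
  obtain ⟨γ, h1, h2, h3, h4⟩ := exists_curve_of_lipschitzWith hf hg hfg
  refine ⟨γ, h1, h2.trans hf0, h3.trans hg0, h4.trans_eq ?_⟩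
  rw [hCr, hTr]
  ring_nf

/-- Theorem 5.1: if a metric space `X` supports an `L`-Lipschitz retraction
`X(4) → X(3)` and `[0,1]` embeds `L`-bi-Lipschitzly into `X`, then any two points
`p, q` with `d(p,q) ≤ 1/(48(L+1)⁵)` are connected by a curve of length at most
`4L²(L+1)² d(p,q)`. (Length of a curve is its total variation.) -/
theorem lipschitz_retraction_implies_local_quasiconvexity {X : Type*} [MetricSpace X]
    (L : ℝ) (hL : 1 ≤ L)
    (r : Set X → Set X) (hr : IsLipschitzRetraction (Set.univ : Set X) 4 3 L r)
    (Γ : ℝ → X)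
    (hΓ : ∀ s ∈ Set.Icc (0 : ℝ) 1, ∀ t ∈ Set.Icc (0 : ℝ) 1,
      L⁻¹ * |s - t| ≤ dist (Γ s) (Γ t) ∧ dist (Γ s) (Γ t) ≤ L * |s - t|) :
    ∀ p q : X, dist p q ≤ 1 / (48 * (L + 1) ^ 5) →
      ∃ γ : ℝ → X, ContinuousOn γ (Set.Icc (0 : ℝ) 1) ∧ γ 0 = p ∧ γ 1 = q ∧
        eVariationOn γ (Set.Icc (0 : ℝ) 1) ≤
          ENNReal.ofReal (4 * L ^ 2 * (L + 1) ^ 2 * dist p q) := by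
  intro p q hpq
  have hL0 : 0 < L := by linarith
  have h01 : 1 / L ≤ dist (Γ 0) (Γ 1) := by
    simpa using (hΓ 0 (by simp) 1 (by simp)).1
  have hhalf : 1 / (2 * L) = 1 / L / 2 := by field_simp
  rcases le_total (1 / (2 * L)) (dist p (Γ 0)) with h | h
  · exact exists_curve_of_dist_le hL hr hΓ hpq h
  · refine exists_curve_of_dist_le (Γ := fun t ↦ Γ (1 - t)) hL hr (fun s hs t ht ↦ ?_) hpq ?_
    · have := hΓ (1 - s) ⟨by linarith [hs.2], by linarith [hs.1]⟩ (1 - t)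
        ⟨by linarith [ht.2], by linarith [ht.1]⟩
      rwa [sub_sub_sub_cancel_left, abs_sub_comm] at this
    · have := dist_triangle_left (Γ 0) (Γ 1) p
      rw [sub_zero]
      linarith
end

section
/- Let X be a metric space and p, q, c ∈ X. If the two-point set {p, q} is connected to the singleton {c} by a curve of length ℓ in the finite subset space X(2) (with the Hausdorff metric), then p and q are connected in X by a curve of length at most 2ℓ. -/
open TopologicalSpace

open Set Filter Topology

/-- If `f` moves no more than `g` varies between any two points of `s`, then the variation of `f`
on `s` is at most that of `g`. -/
theorem eVariationOn_le_of_edist_le {α E F : Type*} [LinearOrder α] [PseudoEMetricSpace E]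
    [PseudoEMetricSpace F] {f : α → E} {g : α → F} {s : Set α}
    (h : ∀ x ∈ s, ∀ y ∈ s, x ≤ y → edist (f x) (f y) ≤ eVariationOn g (s ∩ Icc x y)) :
    eVariationOn f s ≤ eVariationOn g s := by
  refine iSup_le fun ⟨n, u, hu, us⟩ => ?_
  calc ∑ i ∈ Finset.range n, edist (f (u (i + 1))) (f (u i))
      ≤ ∑ i ∈ Finset.range n, eVariationOn g (s ∩ Icc (u i) (u (i + 1))) :=
        Finset.sum_le_sum fun i _ => by
          rw [edist_comm]
          exact h _ (us _) _ (us _) (hu i.le_succ)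
    _ = eVariationOn g (s ∩ Icc (u 0) (u n)) := eVariationOn.sum g hu fun i _ _ => us i
    _ ≤ eVariationOn g s := eVariationOn.mono _ inter_subset_left

/-- If `f` moves no more than a continuous function `g` of bounded variation varies, then `f` is
continuous. -/
theorem continuousOn_of_edist_le_eVariationOn {α E F : Type*} [LinearOrder α]
    [TopologicalSpace α] [OrderTopology α] [PseudoEMetricSpace E] [PseudoEMetricSpace F]
    {f : α → E} {g : α → F} {s : Set α} (hg : ContinuousOn g s) (hgs : BoundedVariationOn g s)
    (h : ∀ x ∈ s, ∀ y ∈ s, x ≤ y → edist (f x) (f y) ≤ eVariationOn g (s ∩ Icc x y)) :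
    ContinuousOn f s := by
  intro x hx
  rw [ContinuousWithinAt, tendsto_iff_edist_tendsto_0]
  have hl := hgs.tendsto_eVariationOn_Icc_zero_left ((hg x hx).mono inter_subset_left)
  have hr := hgs.tendsto_eVariationOn_Icc_zero_right x ((hg x hx).mono inter_subset_left)
  have hlr := hl.add hr
  rw [add_zero] at hlr
  refine tendsto_of_tendsto_of_tendsto_of_le_of_le' tendsto_const_nhds hlr
    (Eventually.of_forall fun _ => zero_le) ?_
  filter_upwards [self_mem_nhdsWithin] with y hy
  rcases le_total y x with hyx | hxy
  · exact (h y hy x hx hyx).trans le_self_add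
  · rw [edist_comm]
    exact (h x hx y hy hxy).trans le_add_self

namespace TopologicalSpace.NonemptyCompacts

variable {α X : Type*} [LinearOrder α] [MetricSpace X]

theorem exists_mem_edist_le (A B : NonemptyCompacts X) {x : X} (hx : x ∈ A) :
    ∃ y ∈ B, edist x y ≤ edist A B := by
  obtain ⟨y, hy, hxy⟩ := B.isCompact.exists_infEDist_eq_edist B.nonempty x
  exact ⟨y, hy, hxy ▸ Metric.infEDist_le_hausdorffEDist_of_mem hx⟩

theorem exists_selection_finset (f : α → NonemptyCompacts X) {s : Set α} {a : α} {p : X}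
    (ha : IsLeast s a) (hp : p ∈ f a) (F : Finset α) (hF : ↑F ⊆ s) :
    ∃ x : α → X, (∀ t, x t ∈ f t) ∧ x a = p ∧ ∀ u ∈ insert a F, ∀ v ∈ insert a F, u ≤ v →
      edist (x u) (x v) ≤ eVariationOn f (s ∩ Icc u v) := by
  classical
  induction F using Finset.induction_on_max with
  | empty =>
    choose x hx using fun t => (f t).nonempty
    refine ⟨Function.update x a p, fun t => ?_, by simp, by simp⟩
    rcases eq_or_ne t a with rfl | ht
    · simpa using hp
    · simpa [ht] using hx t
  | insert m F hm ih =>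
    obtain ⟨x, hx, hxa, hxF⟩ := ih ((Finset.coe_subset.2 (Finset.subset_insert m F)).trans hF)
    have hms : m ∈ s := hF (by simp)
    rcases (ha.2 hms).eq_or_lt with rfl | ham
    · exact ⟨x, hx, hxa, by simpa using hxF⟩
    obtain ⟨k, hk, hkmax⟩ : ∃ k ∈ insert a F, ∀ u ∈ insert a F, u ≤ k :=
      ⟨_, Finset.max'_mem _ (Finset.insert_nonempty a F), Finset.le_max' _⟩
    have hlt : ∀ u ∈ insert a F, u < m := by
      simpa [Finset.forall_mem_insert] using And.intro ham hm
    have hmem : ∀ u ∈ insert a F, u ∈ s := by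
      simpa [Finset.forall_mem_insert] using
        And.intro ha.1 fun u hu => hF (by simp [hu])
    obtain ⟨y, hy, hky⟩ := exists_mem_edist_le (f k) (f m) (hx k)
    have hstep : ∀ u ∈ insert a F, edist (x u) y ≤ eVariationOn f (s ∩ Icc u m) := fun u hu =>
      calc edist (x u) y ≤ edist (x u) (x k) + edist (x k) y := edist_triangle _ _ _
        _ ≤ eVariationOn f (s ∩ Icc u k) + eVariationOn f (s ∩ Icc k m) := by
          refine add_le_add (hxF u hu k hk (hkmax u hu)) (hky.trans ?_)
          exact eVariationOn.edist_le f ⟨hmem k hk, le_rfl, (hlt k hk).le⟩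
            ⟨hms, (hlt k hk).le, le_rfl⟩
        _ = eVariationOn f (s ∩ Icc u m) :=
          eVariationOn.Icc_add_Icc f (hkmax u hu) (hlt k hk).le (hmem k hk)
    refine ⟨Function.update x m y, fun t => ?_, by simp [ham.ne, hxa], fun u hu v hv huv => ?_⟩
    · rcases eq_or_ne t m with rfl | ht
      · simpa using hy
      · simpa [ht] using hx t
    · rw [Finset.insert_comm, Finset.mem_insert] at hu hv
      rcases hu with rfl | hu <;> rcases hv with rfl | hv
      · simp
      · exact absurd huv (hlt v hv).not_ge
      · simpa [(hlt u hu).ne] using hstep u hu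
      · simpa [(hlt u hu).ne, (hlt v hv).ne] using hxF u hu v hv huv

/-- A set-valued function `f` with nonempty compact values has, through any point of its initial
value, a selection that moves no more than `f` varies. -/
theorem exists_selection (f : α → NonemptyCompacts X) {s : Set α} {a : α} {p : X}
    (ha : IsLeast s a) (hp : p ∈ f a) :
    ∃ x : α → X, (∀ t, x t ∈ f t) ∧ x a = p ∧ ∀ u ∈ s, ∀ v ∈ s, u ≤ v →
      edist (x u) (x v) ≤ eVariationOn f (s ∩ Icc u v) := by
  classical
  choose x hx hxa hxF using fun F : Finset s =>
    exists_selection_finset f ha hp (F.map (Function.Embedding.subtype _)) (by simp)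
  let U : Ultrafilter (Finset s) := Ultrafilter.of atTop
  have hU : (U : Filter (Finset s)) ≤ atTop := Ultrafilter.of_le _
  have hlim : ∀ t, ∃ y ∈ f t, Tendsto (fun F => x F t) U (𝓝 y) := fun t =>
    (f t).isCompact.ultrafilter_le_nhds' (U.map fun F => x F t)
      (Ultrafilter.mem_map.2 (univ_mem' fun F => hx F t))
  choose y hy hxy using hlim
  refine ⟨y, hy, ?_, fun u hu v hv huv => ?_⟩
  · exact tendsto_nhds_unique (hxy a) (by simp [hxa])
  · refine le_of_tendsto ((hxy u).edist (hxy v)) ?_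
    filter_upwards [hU (mem_atTop {⟨u, hu⟩, ⟨v, hv⟩})] with F hF
    refine hxF F u ?_ v ?_ huv
    · exact Finset.mem_insert_of_mem (Finset.mem_map.2 ⟨⟨u, hu⟩, hF (by simp), rfl⟩)
    · exact Finset.mem_insert_of_mem (Finset.mem_map.2 ⟨⟨v, hv⟩, hF (by simp), rfl⟩)

/-- Through every point of its initial value, a continuous curve of bounded variation in the space
of nonempty compact sets has a continuous selection of no larger variation. -/
theorem exists_continuousOn_selection [TopologicalSpace α] [OrderTopology α]
    {f : α → NonemptyCompacts X} {s : Set α} {a : α} {p : X} (ha : IsLeast s a) (hp : p ∈ f a)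
    (hf : ContinuousOn f s) (hfs : BoundedVariationOn f s) :
    ∃ x : α → X, ContinuousOn x s ∧ (∀ t, x t ∈ f t) ∧ x a = p ∧
      eVariationOn x s ≤ eVariationOn f s := by
  obtain ⟨x, hx, hxa, hxs⟩ := exists_selection f ha hp
  exact ⟨x, continuousOn_of_edist_le_eVariationOn hf hfs hxs, hx, hxa,
    eVariationOn_le_of_edist_le hxs⟩

end TopologicalSpace.NonemptyCompacts

/-- Two curves on `[a, b]` with a common endpoint at `b` can be joined to a curve on `[0, 1]`
whose variation is at most the sum of theirs. -/
theorem exists_curve_of_common_endpoint {X : Type*} [PseudoEMetricSpace X] {a b : ℝ} (hab : a ≤ b)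
    {x y : ℝ → X} (hx : ContinuousOn x (Icc a b)) (hy : ContinuousOn y (Icc a b))
    (hxy : x b = y b) :
    ∃ γ : ℝ → X, ContinuousOn γ (Icc 0 1) ∧ γ 0 = x a ∧ γ 1 = y a ∧
      eVariationOn γ (Icc 0 1) ≤ eVariationOn x (Icc a b) + eVariationOn y (Icc a b) := by
  let φ : ℝ → ℝ := fun t => a + 2 * t * (b - a)
  let ψ : ℝ → ℝ := fun t => b - (2 * t - 1) * (b - a)
  have hφ : MapsTo φ (Icc 0 (1 / 2)) (Icc a b) := fun t ht => by
    constructor <;> simp only [φ] <;> nlinarith [ht.1, ht.2]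
  have hψ : MapsTo ψ (Icc (1 / 2) 1) (Icc a b) := fun t ht => by
    constructor <;> simp only [ψ] <;> nlinarith [ht.1, ht.2]
  have hφc : Continuous φ := by fun_prop
  have hψc : Continuous ψ := by fun_prop
  let γ : ℝ → X := fun t => if t ≤ 1 / 2 then x (φ t) else y (ψ t)
  have hγφ : EqOn γ (x ∘ φ) (Icc 0 (1 / 2)) := fun t ht => if_pos ht.2
  have hγψ : EqOn γ (y ∘ ψ) (Icc (1 / 2) 1) := fun t ht => by
    rcases ht.1.eq_or_lt with rfl | h
    · simp [γ, φ, ψ, hxy]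
    · exact if_neg h.not_ge
  have hunion : Icc (0 : ℝ) 1 = Icc 0 (1 / 2) ∪ Icc (1 / 2) 1 :=
    (Icc_union_Icc_eq_Icc (by norm_num) (by norm_num)).symm
  refine ⟨γ, ?_, ?_, ?_, ?_⟩
  · rw [hunion]
    exact ((hx.comp hφc.continuousOn hφ).congr hγφ).union_of_isClosed
      ((hy.comp hψc.continuousOn hψ).congr hγψ) isClosed_Icc isClosed_Icc
  · simp [γ, φ]
  · rw [hγψ ⟨by norm_num, le_rfl⟩]
    simp only [Function.comp_apply, ψ]
    congr 1
    ring
  · rw [hunion, eVariationOn.union γ (isGreatest_Icc (by norm_num)) (isLeast_Icc (by norm_num)),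
      eVariationOn.congr hγφ, eVariationOn.congr hγψ]
    refine add_le_add (eVariationOn.comp_le_of_monotoneOn x φ (fun s _ t _ hst => ?_) hφ)
      (eVariationOn.comp_le_of_antitoneOn y ψ (fun s _ t _ hst => ?_) hψ) <;>
    simp only [φ, ψ] <;> nlinarith

/-- Lemma 5.4: if the two-point set `{p, q}` is connected to a singleton `{c}` by a
curve of length `ℓ` in the finite subset space `X(2)` (with the Hausdorff metric, here
realized inside the space of nonempty compact subsets of `X`, whose metric is the
Hausdorff metric), then `p` and `q` are connected in `X` by a curve of length at most
`2ℓ`. (Length of a curve is its total variation.) -/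
theorem two_point_set_connected_to_singleton {X : Type*} [MetricSpace X]
    (p q c : X) (ℓ : ℝ) (a b : ℝ) (hab : a ≤ b)
    (Γ : ℝ → NonemptyCompacts X)
    (hmem : ∀ t ∈ Set.Icc a b, (Γ t : Set X).Finite ∧ (Γ t : Set X).ncard ≤ 2)
    (hcont : ContinuousOn Γ (Set.Icc a b))
    (hstart : (Γ a : Set X) = {p, q}) (hend : (Γ b : Set X) = {c})
    (hlen : eVariationOn Γ (Set.Icc a b) ≤ ENNReal.ofReal ℓ) :
    ∃ γ : ℝ → X, ContinuousOn γ (Set.Icc (0 : ℝ) 1) ∧ γ 0 = p ∧ γ 1 = q ∧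
      eVariationOn γ (Set.Icc (0 : ℝ) 1) ≤ ENNReal.ofReal (2 * ℓ) := by
  have hbv : BoundedVariationOn Γ (Set.Icc a b) := (hlen.trans_lt ENNReal.ofReal_lt_top).ne
  have hp : p ∈ Γ a := by simp [← SetLike.mem_coe, hstart]
  have hq : q ∈ Γ a := by simp [← SetLike.mem_coe, hstart]
  have hc : ∀ z ∈ Γ b, z = c := fun z hz => by simpa [← SetLike.mem_coe, hend] using hz
  obtain ⟨x, hx, hxΓ, hxa, hxlen⟩ :=
    NonemptyCompacts.exists_continuousOn_selection (isLeast_Icc hab) hp hcont hbv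
  obtain ⟨y, hy, hyΓ, hya, hylen⟩ :=
    NonemptyCompacts.exists_continuousOn_selection (isLeast_Icc hab) hq hcont hbv
  obtain ⟨γ, hγ, hγ0, hγ1, hγlen⟩ := exists_curve_of_common_endpoint hab hx hy
    ((hc _ (hxΓ b)).trans (hc _ (hyΓ b)).symm)
  refine ⟨γ, hγ, hγ0.trans hxa, hγ1.trans hya, hγlen.trans ?_⟩
  rw [ENNReal.ofReal_mul zero_le_two, ENNReal.ofReal_ofNat, two_mul]
  exact add_le_add (hxlen.trans hlen) (hylen.trans hlen)
end

section
/- Suppose (X, d) is a metric space with the Lipschitz Clustering Property, and φ : [0,∞) → [0,∞) is a nondecreasing function such that φ∘d is a metric on X and φ satisfies the doubling condition φ(2t) ≤ M·φ(t) for all t ∈ [0,∞) and some constant M. Then the metric space (X, φ∘d) has the Lipschitz Clustering Property. -/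
open Metric

theorem Set.Finite.hausdorffEDist_ne_top {X : Type*} [MetricSpace X] {A B : Set X}
    (hA : A.Finite) (hA' : A.Nonempty) (hB : B.Finite) (hB' : B.Nonempty) :
    hausdorffEDist A B ≠ ⊤ :=
  hausdorffEDist_ne_top_of_nonempty_of_bounded hA' hB' hA.isBounded hB.isBounded

theorem Set.Finite.exists_dist_le_hausdorffDist {X : Type*} [MetricSpace X] {A B : Set X}
    (hA : A.Finite) (hB : B.Finite) (hB' : B.Nonempty) {a : X} (ha : a ∈ A) :
    ∃ b ∈ B, dist a b ≤ hausdorffDist A B := by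
  obtain ⟨b, hb, h⟩ := hB.isCompact.exists_infDist_eq_dist hB' a
  exact ⟨b, hb, h ▸ infDist_le_hausdorffDist_of_mem ha
    (hA.hausdorffEDist_ne_top ⟨a, ha⟩ hB hB')⟩

theorem Set.Finite.exists_hausdorffDist_le_dist {X : Type*} [MetricSpace X] {A B : Set X}
    (hA : A.Finite) (hA' : A.Nonempty) (hB : B.Finite) (hB' : B.Nonempty) :
    (∃ a ∈ A, ∀ b ∈ B, hausdorffDist A B ≤ dist a b) ∨
      ∃ b ∈ B, ∀ a ∈ A, hausdorffDist A B ≤ dist b a := by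
  obtain ⟨a₀, ha₀, hmaxA⟩ := Set.exists_max_image A (infDist · B) hA hA'
  obtain ⟨b₀, hb₀, hmaxB⟩ := Set.exists_max_image B (infDist · A) hB hB'
  have h : hausdorffDist A B ≤ max (infDist a₀ B) (infDist b₀ A) :=
    hausdorffDist_le_of_infDist (infDist_nonneg.trans (le_max_left _ _))
      (fun x hx => (hmaxA x hx).trans (le_max_left _ _))
      (fun x hx => (hmaxB x hx).trans (le_max_right _ _))
  rcases le_max_iff.1 h with h | h
  · exact .inl ⟨a₀, ha₀, fun b hb => h.trans (infDist_le_dist_of_mem hb)⟩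
  · exact .inr ⟨b₀, hb₀, fun a ha => h.trans (infDist_le_dist_of_mem ha)⟩

/-- A nondecreasing transform of the metric transforms the Hausdorff distance of finite sets
in the same way. -/
theorem Set.Finite.hausdorffDist_image_of_dist_eq {X Y : Type*} [MetricSpace X] [MetricSpace Y]
    {φ : ℝ → ℝ} (hmono : ∀ s t, 0 ≤ s → s ≤ t → φ s ≤ φ t) {e : X → Y}
    (hmetric : ∀ x x' : X, dist (e x) (e x') = φ (dist x x')) {A B : Set X}
    (hA : A.Finite) (hA' : A.Nonempty) (hB : B.Finite) (hB' : B.Nonempty) :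
    hausdorffDist (e '' A) (e '' B) = φ (hausdorffDist A B) := by
  have hle : ∀ {C D : Set X}, C.Finite → D.Finite → D.Nonempty → ∀ y ∈ e '' C,
      ∃ z ∈ e '' D, dist y z ≤ φ (hausdorffDist C D) := by
    rintro C D hC hD hD' _ ⟨x, hx, rfl⟩
    obtain ⟨b, hb, h⟩ := hC.exists_dist_le_hausdorffDist hD hD' hx
    exact ⟨e b, mem_image_of_mem e hb, hmetric x b ▸ hmono _ _ dist_nonneg h⟩
  have hge : ∀ {C D : Set X}, C.Finite → D.Finite → D.Nonempty →
      (∃ c ∈ C, ∀ d ∈ D, hausdorffDist C D ≤ dist c d) →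
      φ (hausdorffDist C D) ≤ hausdorffDist (e '' C) (e '' D) := by
    rintro C D hC hD hD' ⟨c, hc, h⟩
    obtain ⟨_, ⟨d, hd, rfl⟩, hd'⟩ := (hC.image e).exists_dist_le_hausdorffDist (hD.image e)
      (hD'.image e) (mem_image_of_mem e hc)
    rw [hmetric] at hd'
    exact (hmono _ _ hausdorffDist_nonneg (h d hd)).trans hd'
  refine le_antisymm (hausdorffDist_le_of_mem_dist ?_ (hle hA hB hB') ?_) ?_
  · obtain ⟨x, hx⟩ := hA'
    obtain ⟨z, -, hz⟩ := hle hA hB hB' (e x) (mem_image_of_mem e hx)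
    exact dist_nonneg.trans hz
  · rw [hausdorffDist_comm]
    exact hle hB hA hA'
  · rcases hA.exists_hausdorffDist_le_dist hA' hB hB' with h | h
    · exact hge hA hB hB' h
    · rw [hausdorffDist_comm (s := A), hausdorffDist_comm (s := e '' A)]
      rw [hausdorffDist_comm] at h
      exact hge hB hA hA' h

theorem apply_two_pow_mul_le_of_doubling {φ : ℝ → ℝ} {M : ℝ} (hM : 0 ≤ M)
    (hdbl : ∀ t, 0 ≤ t → φ (2 * t) ≤ M * φ t) (k : ℕ) {t : ℝ} (ht : 0 ≤ t) :
    φ (2 ^ k * t) ≤ M ^ k * φ t := by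
  induction k with
  | zero => simp
  | succ k ih =>
    calc φ (2 ^ (k + 1) * t) = φ (2 * (2 ^ k * t)) := by ring_nf
      _ ≤ M * φ (2 ^ k * t) := hdbl _ (by positivity)
      _ ≤ M * (M ^ k * φ t) := by gcongr
      _ = M ^ (k + 1) * φ t := by ring

theorem MemFinSubsetSpace.image_equiv {X Y : Type*} (e : X ≃ Y) {n : ℕ} {A : Set X}
    (hA : MemFinSubsetSpace Set.univ n A) : MemFinSubsetSpace Set.univ n (e '' A) :=
  ⟨hA.1.image e, hA.2.1.image e, (Set.ncard_image_of_injective A e.injective).trans_le hA.2.2.1,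
    Set.subset_univ _⟩

/-- Lemma 6.4: suppose `(X, d)` has the Lipschitz Clustering Property and
`φ : [0,∞) → [0,∞)` is a nondecreasing doubling function (`φ(2t) ≤ M φ(t)`) such that
`φ ∘ d` is a metric on `X`. Then `(X, φ ∘ d)` has the Lipschitz Clustering Property.
Here the metric space `(X, φ ∘ d)` is realized as a metric space `Y` together with a
bijection `e : X ≃ Y` satisfying `dist (e x) (e x') = φ (dist x x')`. -/
theorem metric_transform_preserves_LCP {X Y : Type*} [MetricSpace X] [MetricSpace Y]
    (φ : ℝ → ℝ) (hφ0 : ∀ t, 0 ≤ t → 0 ≤ φ t)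
    (hmono : ∀ s t, 0 ≤ s → s ≤ t → φ s ≤ φ t)
    (M : ℝ) (hdbl : ∀ t, 0 ≤ t → φ (2 * t) ≤ M * φ t)
    (e : X ≃ Y) (hmetric : ∀ x x' : X, dist (e x) (e x') = φ (dist x x'))
    (hX : HasLCP (Set.univ : Set X)) :
    HasLCP (Set.univ : Set Y) := by
  intro n hn
  obtain ⟨L, r, hmem, hfix, hlip⟩ := hX n hn
  obtain ⟨k, hk⟩ := pow_unbounded_of_one_lt L (one_lt_two : (1 : ℝ) < 2)
  have hdbl' : ∀ t, 0 ≤ t → φ (2 * t) ≤ |M| * φ t := fun t ht =>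
    (hdbl t ht).trans (mul_le_mul_of_nonneg_right (le_abs_self M) (hφ0 t ht))
  refine ⟨|M| ^ k, fun S => e '' r (e.symm '' S), fun S hS => ?_, fun S hS => ?_,
    fun S T hS hT => ?_⟩
  · exact (hmem _ (hS.image_equiv e.symm)).image_equiv e
  · simp only [hfix _ (hS.image_equiv e.symm), Equiv.image_symm_image]
  · have hA := hS.image_equiv e.symm
    have hB := hT.image_equiv e.symm
    have hST := hA.1.hausdorffDist_image_of_dist_eq hmono hmetric hA.2.1 hB.1 hB.2.1
    rw [Equiv.image_symm_image, Equiv.image_symm_image] at hST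
    have hrA := hmem _ hA
    have hrB := hmem _ hB
    rw [hrA.1.hausdorffDist_image_of_dist_eq hmono hmetric hrA.2.1 hrB.1 hrB.2.1, hST]
    refine (hmono _ _ hausdorffDist_nonneg ((hlip _ _ hA hB).trans ?_)).trans
      (apply_two_pow_mul_le_of_doubling (abs_nonneg M) hdbl' k hausdorffDist_nonneg)
    exact mul_le_mul_of_nonneg_right hk.le hausdorffDist_nonneg
end
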